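/- arXiv:math/0404075 — 4 statements merged into one kernel-verified Lean document; each statement's English description precedes it below -/
import Mathlib

section
/- Every finitely generated virtually polycyclic group of exponential growth has uniformly exponential growth, i.e., ω(G) > 1. -/
section GrowthDefs

variable {G : Type*} [Group G]

/-- The ball of radius `n` w.r.t. a finite set `X`: all elements of `G` that are products
of at most `n` letters from `X ∪ X⁻¹`. -/
def wordBall (X : Finset G) (n : ℕ) : Set G :=
  {g | ∃ l : List G, l.length ≤ n ∧ (∀ x ∈ l, x ∈ X ∨ x⁻¹ ∈ X) ∧ l.prod = g}

/-- The growth function `γ_G^X(n) = card {g ∈ G : ‖g‖_X ≤ n}`. -/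
noncomputable def growthFn (X : Finset G) (n : ℕ) : ℕ :=
  Nat.card (wordBall X n)

/-- The exponential growth rate `ω(G,X) = lim_{n→∞} γ_G^X(n)^{1/n}`, which by
submultiplicativity of the growth function equals `inf_{n ≥ 1} γ_G^X(n)^{1/n}`. -/
noncomputable def growthRateX (X : Finset G) : ℝ :=
  ⨅ n : ℕ, (growthFn X (n + 1) : ℝ) ^ ((1 : ℝ) / (n + 1))

/-- The minimal exponential growth rate `ω(G) = inf_X ω(G,X)`, the infimum being taken
over all finite generating sets `X` of `G`. -/
noncomputable def minGrowthRate (G : Type*) [Group G] : ℝ :=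
  sInf {r : ℝ | ∃ X : Finset G, Subgroup.closure (X : Set G) = ⊤ ∧ r = growthRateX X}

/-- `G` has exponential growth: `ω(G,X) > 1` for some (equivalently, every) finite
generating set `X`. -/
def HasExponentialGrowth (G : Type*) [Group G] : Prop :=
  ∃ X : Finset G, Subgroup.closure (X : Set G) = ⊤ ∧ 1 < growthRateX X

end GrowthDefs

/-- A group `G` is polycyclic if it admits a finite subnormal series
`1 = P_k ⊴ P_{k-1} ⊴ … ⊴ P_0 = G` with all quotients `P_{i-1}/P_i` cyclic: each term
is normal in the next one and the corresponding quotient is generated by the image of a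
single element `g`. -/
def IsPolycyclic (G : Type*) [Group G] : Prop :=
  ∃ (n : ℕ) (P : Fin (n + 1) → Subgroup G),
    P 0 = ⊥ ∧ P (Fin.last n) = ⊤ ∧
    ∀ i : Fin n,
      P i.castSucc ≤ P i.succ ∧
      (∀ x ∈ P i.succ, ∀ h ∈ P i.castSucc, x * h * x⁻¹ ∈ P i.castSucc) ∧
      (∃ g ∈ P i.succ, ∀ x ∈ P i.succ, ∃ k : ℤ, (g ^ k)⁻¹ * x ∈ P i.castSucc)

/-- A group is virtually polycyclic if it has a polycyclic subgroup of finite index. -/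
def IsVirtuallyPolycyclic (G : Type*) [Group G] : Prop :=
  ∃ H : Subgroup G, H.FiniteIndex ∧ IsPolycyclic H

section WordGrowth

open scoped Pointwise

variable {G : Type*} [Group G]

/-- The unit ball of the word metric of `S`: the identity, the elements of `S`, and their
inverses. -/
def unitBall (S : Set G) : Set G := insert 1 (S ∪ S⁻¹)

lemma one_mem_unitBall (S : Set G) : (1 : G) ∈ unitBall S := Set.mem_insert _ _

lemma subset_unitBall (S : Set G) : S ⊆ unitBall S := fun _ hx => Or.inr (Or.inl hx)

lemma inv_mem_unitBall {S : Set G} {x : G} (hx : x ∈ unitBall S) : x⁻¹ ∈ unitBall S := by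
  rcases hx with rfl | hx | hx
  · simp [one_mem_unitBall]
  · exact Or.inr (Or.inr (by simpa using hx))
  · exact Or.inr (Or.inl hx)

lemma unitBall_inv (S : Set G) : (unitBall S)⁻¹ = unitBall S := by
  ext x
  exact ⟨fun h => by simpa using inv_mem_unitBall h, fun h => inv_mem_unitBall h⟩

lemma unitBall_pow_mono (S : Set G) {m n : ℕ} (h : m ≤ n) : unitBall S ^ m ⊆ unitBall S ^ n :=
  Set.pow_subset_pow_right (one_mem_unitBall S) h

lemma inv_mem_unitBall_pow {S : Set G} {x : G} {n : ℕ} (hx : x ∈ unitBall S ^ n) :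
    x⁻¹ ∈ unitBall S ^ n := by
  rw [← Set.mem_inv, ← inv_pow, unitBall_inv]
  exact hx

lemma unitBall_image {H : Type*} [Group H] (f : G →* H) (S : Set G) :
    unitBall (f '' S) = f '' unitBall S := by
  simp only [unitBall, Set.image_insert_eq, map_one, Set.image_union, Set.image_inv]

lemma wordBall_eq_unitBall_pow (X : Finset G) (n : ℕ) :
    wordBall X n = unitBall (X : Set G) ^ n := by
  ext g
  constructor
  · rintro ⟨l, hl, hx, rfl⟩
    refine unitBall_pow_mono _ hl ?_
    clear hl
    induction l with
    | nil => simp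
    | cons a l ih =>
      rw [List.prod_cons, List.length_cons, pow_succ']
      refine Set.mul_mem_mul ?_ (ih fun x h => hx x (List.mem_cons_of_mem _ h))
      exact Or.inr (by simpa using hx a List.mem_cons_self)
  · intro h
    induction n generalizing g with
    | zero =>
      rw [pow_zero, Set.mem_one] at h
      exact ⟨[], by simp [h]⟩
    | succ n ih =>
      rw [pow_succ'] at h
      obtain ⟨a, ha, b, hb, rfl⟩ := h
      obtain ⟨l, hl, hx, rfl⟩ := ih b hb
      rcases ha with rfl | ha
      · exact ⟨l, by omega, hx, by simp⟩
      · refine ⟨a :: l, by simpa using hl, ?_, by simp⟩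
        intro x hx'
        rcases List.mem_cons.1 hx' with rfl | hx'
        · simpa using ha
        · exact hx x hx'

open Classical in
lemma growthFn_eq_card (X : Finset G) :
    ∃ T : Finset G, (T : Set G) = unitBall (X : Set G) ∧ ∀ n, growthFn X n = (T ^ n).card := by
  refine ⟨insert 1 (X ∪ X⁻¹), by simp [unitBall], fun n => ?_⟩
  rw [growthFn, wordBall_eq_unitBall_pow]
  have : unitBall (X : Set G) ^ n = ((insert 1 (X ∪ X⁻¹) ^ n : Finset G) : Set G) := by
    simp [unitBall]
  rw [this, Nat.card_coe_set_eq, Set.ncard_coe_finset]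

/-- The elements `u` and `v` freely generate a free semigroup, expressed on words of equal
length. -/
def FreePair (u v : G) : Prop :=
  ∀ l l' : List Bool, l.length = l'.length →
    (l.map fun b => cond b u v).prod = (l'.map fun b => cond b u v).prod → l = l'

/-- Every generating set has, within a uniform distance from the identity, two elements
generating a free semigroup. -/
def UniformlyFreeSemigroup (G : Type*) [Group G] : Prop :=
  ∃ L : ℕ, ∀ S : Set G, Subgroup.closure S = ⊤ →
    ∃ u ∈ unitBall S ^ L, ∃ v ∈ unitBall S ^ L, FreePair u v

lemma map_prod_map_cond {H : Type*} [Group H] (f : G →* H) (u v : G) (l : List Bool) :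
    f (l.map fun b => cond b u v).prod = (l.map fun b => cond b (f u) (f v)).prod := by
  induction l with
  | nil => simp
  | cons b l ih => cases b <;> simp [ih]

lemma FreePair.of_map {H : Type*} [Group H] (f : G →* H) {u v : G} (h : FreePair (f u) (f v)) :
    FreePair u v := by
  intro l l' hl he
  apply h l l' hl
  rw [← map_prod_map_cond, ← map_prod_map_cond, he]

lemma FreePair.map_injective {H : Type*} [Group H] (f : G →* H) (hf : Function.Injective f)
    {u v : G} (h : FreePair u v) : FreePair (f u) (f v) := by
  intro l l' hl he
  rw [← map_prod_map_cond, ← map_prod_map_cond] at he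
  exact h l l' hl (hf he)

open Classical in
lemma FreePair.two_pow_le {T : Finset G} {L : ℕ} {u v : G} (h : FreePair u v)
    (hu : u ∈ T ^ L) (hv : v ∈ T ^ L) (n : ℕ) : 2 ^ n ≤ (T ^ (L * n)).card := by
  have key : ∀ l : List Bool, (l.map fun b => cond b u v).prod ∈ T ^ (L * l.length) := by
    intro l
    induction l with
    | nil => simp
    | cons b l ih =>
      rw [List.map_cons, List.prod_cons, List.length_cons, Nat.mul_succ, add_comm, pow_add]
      refine Finset.mul_mem_mul ?_ ih
      cases b <;> assumption
  have := Finset.card_le_card_of_injOn (s := (Finset.univ : Finset (List.Vector Bool n)))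
    (t := T ^ (L * n)) (fun l => (l.1.map fun b => cond b u v).prod)
    (fun l _ => by have := key l.1; rw [l.2] at this; exact this)
    (fun l _ l' _ e => Subtype.ext (h _ _ (l.2.trans l'.2.symm) e))
  simpa using this

lemma UniformlyFreeSemigroup.of_surjective {H : Type*} [Group H] (f : G →* H)
    (hf : Function.Surjective f) (h : UniformlyFreeSemigroup H) : UniformlyFreeSemigroup G := by
  obtain ⟨L, hL⟩ := h
  refine ⟨L, fun S hS => ?_⟩
  have hS' : Subgroup.closure (f '' S) = ⊤ := by
    rw [← MonoidHom.map_closure, hS, Subgroup.map_top_of_surjective f hf]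
  obtain ⟨u, hu, v, hv, huv⟩ := hL _ hS'
  rw [unitBall_image, ← Set.image_pow] at hu hv
  obtain ⟨u, hu, rfl⟩ := hu
  obtain ⟨v, hv, rfl⟩ := hv
  exact ⟨u, hu, v, hv, huv.of_map f⟩

theorem UniformlyFreeSemigroup.one_lt_minGrowthRate (hfg : Group.FG G)
    (h : UniformlyFreeSemigroup G) : 1 < minGrowthRate G := by
  classical
  obtain ⟨L, hL⟩ := h
  have hc : (1 : ℝ) < 2 ^ ((1 : ℝ) / (L + 1)) :=
    Real.one_lt_rpow (by norm_num) (by positivity)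
  refine hc.trans_le (le_csInf ?_ ?_)
  · obtain ⟨X, hX⟩ := Group.fg_def.1 hfg
    exact ⟨_, X, hX, rfl⟩
  · rintro _ ⟨X, hX, rfl⟩
    obtain ⟨T, hT, hcard⟩ := growthFn_eq_card X
    obtain ⟨u, hu, v, hv, huv⟩ := hL X hX
    rw [← hT, ← Finset.coe_pow, Finset.mem_coe] at hu hv
    have h1 : (1 : G) ∈ T := by
      rw [← Finset.mem_coe, hT]; exact one_mem_unitBall _
    have hu' := Finset.pow_subset_pow_right h1 (Nat.le_succ L) hu
    have hv' := Finset.pow_subset_pow_right h1 (Nat.le_succ L) hv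
    refine le_ciInf fun n => ?_
    have h2 : (2 : ℝ) ^ (n + 1) ≤ (growthFn X (n + 1) : ℝ) ^ (L + 1) := by
      have h3 := huv.two_pow_le hu' hv' (n + 1)
      have h4 : (T ^ ((L + 1) * (n + 1))).card ≤ (T ^ (n + 1)).card ^ (L + 1) := by
        rw [mul_comm, pow_mul]
        exact Finset.card_pow_le
      rw [hcard]
      exact_mod_cast h3.trans h4
    have h5 := Real.rpow_le_rpow (by positivity) h2
      (show (0 : ℝ) ≤ 1 / ((L + 1) * (n + 1)) by positivity)
    rw [← Real.rpow_natCast, ← Real.rpow_natCast, ← Real.rpow_mul (by positivity),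
      ← Real.rpow_mul (by positivity)] at h5
    have e1 : ((n + 1 : ℕ) : ℝ) * (1 / ((L + 1) * (n + 1))) = 1 / (L + 1) := by
      push_cast; field_simp
    have e2 : ((L + 1 : ℕ) : ℝ) * (1 / ((L + 1) * (n + 1))) = 1 / (n + 1) := by
      push_cast; field_simp
    rwa [e1, e2] at h5

end WordGrowth

section FiniteIndex

open scoped Pointwise

variable {G : Type*} [Group G]

lemma exists_mem_unitBall_pow_index (H : Subgroup G) [H.FiniteIndex] {S : Set G}
    (hS : Subgroup.closure S = ⊤) (q : G ⧸ H) :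
    ∃ g ∈ unitBall S ^ H.index, (g : G ⧸ H) = q := by
  set C : ℕ → Set (G ⧸ H) := fun n => (fun g : G => (g : G ⧸ H)) '' (unitBall S ^ n) with hC
  have hmono : ∀ n, C n ⊆ C (n + 1) := fun n =>
    Set.image_mono (unitBall_pow_mono S n.le_succ)
  have hmul : ∀ (n : ℕ) (x g : G), x ∈ unitBall S → (g : G ⧸ H) ∈ C n →
      ((x * g : G) : G ⧸ H) ∈ C (n + 1) := by
    rintro n x g hx ⟨g', hg', he⟩
    refine ⟨x * g', ?_, ?_⟩
    · rw [pow_succ']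
      exact Set.mul_mem_mul hx hg'
    · have he : (g' : G ⧸ H) = g := he
      change ((x * g' : G) : G ⧸ H) = ((x * g : G) : G ⧸ H)
      rw [QuotientGroup.eq] at he ⊢
      simpa [mul_assoc] using he
  have hone : ∀ n, ((1 : G) : G ⧸ H) ∈ C n := fun n =>
    ⟨1, unitBall_pow_mono S (Nat.zero_le n) (by simp), rfl⟩
  have hstab : ∀ n, C (n + 1) ⊆ C n → C n = Set.univ := by
    intro n hn
    refine Set.eq_univ_of_forall fun q => ?_
    induction q using QuotientGroup.induction_on with
    | H g =>
      have hg : g ∈ Subgroup.closure S := hS ▸ Subgroup.mem_top g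
      induction hg using Subgroup.closure_induction_left with
      | one => exact hone n
      | mul_left x hx y _ ih => exact hn (hmul n x y (subset_unitBall S hx) ih)
      | inv_mul_cancel x hx y _ ih =>
        exact hn (hmul n _ y (inv_mem_unitBall (subset_unitBall S hx)) ih)
  have hcard : ∀ n, C n = Set.univ ∨ n + 1 ≤ (C n).ncard := by
    intro n
    induction n with
    | zero =>
      right
      exact (Set.ncard_pos (Set.toFinite _)).2 ⟨_, hone 0⟩
    | succ n ih =>
      rcases ih with ih | ih
      · exact Or.inl (Set.eq_univ_of_univ_subset (ih ▸ hmono n))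
      · by_cases h : C (n + 1) ⊆ C n
        · exact Or.inl (Set.eq_univ_of_univ_subset (hstab n h ▸ hmono n))
        · right
          have := Set.ncard_lt_ncard (Set.ssubset_iff_subset_ne.2
            ⟨hmono n, fun e => h e.symm.subset⟩) (Set.toFinite _)
          omega
  rcases hcard H.index with h | h
  · exact (h ▸ Set.mem_univ q : q ∈ C H.index)
  · have h1 : (C H.index).ncard ≤ H.index := by
      rw [Subgroup.index, ← Set.ncard_univ]
      exact Set.ncard_le_ncard (Set.subset_univ _) (Set.toFinite _)
    omega

lemma closure_subgroup_inter_unitBall_pow (H : Subgroup G) [H.FiniteIndex] {S : Set G}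
    (hS : Subgroup.closure S = ⊤) :
    Subgroup.closure {h : H | (h : G) ∈ unitBall S ^ (2 * H.index + 1)} = ⊤ := by
  choose r hr hrq using exists_mem_unitBall_pow_index H hS
  set Y : Set H := {h : H | (h : G) ∈ unitBall S ^ (2 * H.index + 1)} with hY
  set K : Subgroup G := (Subgroup.closure Y).map H.subtype with hK
  have hmem : ∀ g ∈ H, g ∈ unitBall S ^ (2 * H.index + 1) → g ∈ K := fun g hg hg' =>
    ⟨⟨g, hg⟩, Subgroup.subset_closure hg', rfl⟩
  have hstep : ∀ x ∈ unitBall S, ∀ g : G, (r g)⁻¹ * g ∈ K →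
      (r ((x * g : G) : G ⧸ H))⁻¹ * (x * g) ∈ K := by
    intro x hx g hg
    have h1 : (r ((x * g : G) : G ⧸ H))⁻¹ * x * r g ∈ K := by
      apply hmem
      · rw [mul_assoc, ← QuotientGroup.eq, hrq]
        have := hrq (g : G ⧸ H)
        rw [QuotientGroup.eq] at this ⊢
        have := H.inv_mem this
        simpa [mul_assoc] using this
      · rw [show 2 * H.index + 1 = H.index + 1 + H.index by ring, pow_add, pow_succ]
        exact Set.mul_mem_mul (Set.mul_mem_mul (inv_mem_unitBall_pow (hr _)) hx) (hr _)
    have := K.mul_mem h1 hg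
    simpa [mul_assoc] using this
  have hle : ∀ g ∈ H, r g ∈ K := by
    intro g hg
    apply hmem _ _ (unitBall_pow_mono S (by omega) (hr _))
    have := hrq (g : G ⧸ H)
    rw [QuotientGroup.eq] at this
    have := H.mul_mem hg (H.inv_mem this)
    simpa using this
  have hall : ∀ g : G, (r g)⁻¹ * g ∈ K := by
    intro g
    have hg : g ∈ Subgroup.closure S := hS ▸ Subgroup.mem_top g
    induction hg using Subgroup.closure_induction_left with
    | one => simpa using hle 1 H.one_mem
    | mul_left x hx y _ ih => exact hstep x (subset_unitBall S hx) y ih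
    | inv_mul_cancel x hx y _ ih =>
      exact hstep _ (inv_mem_unitBall (subset_unitBall S hx)) y ih
  refine Subgroup.eq_top_iff' _ |>.2 fun h => ?_
  have h1 : (h : G) ∈ K := by
    have := K.mul_mem (hle h h.2) (hall h)
    simpa using this
  obtain ⟨h', hh', he⟩ := h1
  exact (Subtype.ext he : h' = h) ▸ hh'

theorem UniformlyFreeSemigroup.of_finiteIndex (H : Subgroup G) [H.FiniteIndex]
    (h : UniformlyFreeSemigroup H) : UniformlyFreeSemigroup G := by
  obtain ⟨L, hL⟩ := h
  refine ⟨(2 * H.index + 1) * L, fun S hS => ?_⟩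
  obtain ⟨u, hu, v, hv, huv⟩ := hL _ (closure_subgroup_inter_unitBall_pow H hS)
  have key : ∀ w ∈ unitBall {h : H | (h : G) ∈ unitBall S ^ (2 * H.index + 1)} ^ L,
      (w : G) ∈ unitBall S ^ ((2 * H.index + 1) * L) := by
    intro w hw
    have h1 : H.subtype '' unitBall {h : H | (h : G) ∈ unitBall S ^ (2 * H.index + 1)} ⊆
        unitBall S ^ (2 * H.index + 1) := by
      rintro _ ⟨x, rfl | hx | hx, rfl⟩
      · exact unitBall_pow_mono S (Nat.zero_le _) (by simp)
      · exact hx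
      · simpa using inv_mem_unitBall_pow (show ((x⁻¹ : H) : G) ∈ _ from hx)
    have h2 := Set.mem_image_of_mem H.subtype hw
    rw [Set.image_pow] at h2
    rw [pow_mul]
    exact Set.pow_subset_pow_left h1 h2
  exact ⟨u, key u hu, v, key v hv, huv.map_injective H.subtype H.subtype_injective⟩

end FiniteIndex

section Subexponential

open scoped Pointwise IsMulCommutative

variable {G : Type*} [Group G]

open Classical in
/-- The powers of every finite subset grow subexponentially. -/
def SubexponentialGrowth (G : Type*) [Group G] : Prop :=
  ∀ T : Finset G, ∀ c : ℝ, 1 < c → ∃ n : ℕ, 0 < n ∧ ((T ^ n).card : ℝ) ≤ c ^ n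

lemma exists_mul_pow_le_pow {c : ℝ} (hc : 1 < c) (D : ℝ) (d : ℕ) :
    ∃ k : ℕ, 0 < k ∧ D * (k + 1 : ℝ) ^ d ≤ c ^ k := by
  have h := tendsto_pow_const_div_const_pow_of_one_lt d hc
  have h1 : Filter.Tendsto (fun k : ℕ => (D * c) * (((k + 1 : ℕ) : ℝ) ^ d / c ^ (k + 1)))
      Filter.atTop (nhds ((D * c) * 0)) :=
    ((Filter.tendsto_add_atTop_iff_nat 1).2 h).const_mul _
  rw [mul_zero] at h1
  obtain ⟨k, hk, hk0⟩ := ((h1.eventually (gt_mem_nhds one_pos)).and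
    (Filter.eventually_gt_atTop 0)).exists
  refine ⟨k, hk0, ?_⟩
  have hck : 0 < c ^ k := by positivity
  have e : (D * c) * (((k + 1 : ℕ) : ℝ) ^ d / c ^ (k + 1)) = D * (k + 1 : ℝ) ^ d / c ^ k := by
    push_cast; rw [pow_succ]; field_simp
  rw [e, div_lt_one hck] at hk
  exact hk.le

lemma exists_sq_eq_of_one_lt {c : ℝ} (hc : 1 < c) : ∃ b : ℝ, 1 < b ∧ b * b = c :=
  ⟨√c, by rw [Real.lt_sqrt] <;> linarith, Real.mul_self_sqrt (by linarith)⟩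

theorem SubexponentialGrowth.of_finiteIndex (H : Subgroup G) [H.FiniteIndex]
    (h : SubexponentialGrowth H) : SubexponentialGrowth G := by
  classical
  intro T c hc
  have : Fintype (G ⧸ H) := Fintype.ofFinite _
  let r : G → G := fun g => ((g⁻¹ : G) : G ⧸ H).out⁻¹
  have hr : ∀ g, g * (r g)⁻¹ ∈ H := by
    intro g
    have := QuotientGroup.out_eq' ((g⁻¹ : G) : G ⧸ H)
    rw [QuotientGroup.eq] at this
    have := H.inv_mem this
    simpa [r] using this
  let R : Finset G := insert 1 (Finset.univ.image fun q : G ⧸ H => q.out⁻¹)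
  let Y : Finset H := (R * T).image fun g => ⟨g * (r g)⁻¹, hr g⟩
  have hRT : R * T ⊆ Y.image H.subtype * R := by
    intro g hg
    refine Finset.mem_mul.2 ⟨g * (r g)⁻¹, ?_, r g, ?_, by simp⟩
    · exact Finset.mem_image.2 ⟨_, Finset.mem_image_of_mem _ hg, rfl⟩
    · exact Finset.mem_insert_of_mem (Finset.mem_image_of_mem _ (Finset.mem_univ _))
  have hTn : ∀ n, T ^ n ⊆ (Y ^ n).image H.subtype * R := by
    intro n
    induction n with
    | zero => simp [R, Finset.singleton_one]
    | succ n ih =>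
      calc T ^ (n + 1) = T ^ n * T := pow_succ _ _
        _ ⊆ (Y ^ n).image H.subtype * R * T := Finset.mul_subset_mul_right ih
        _ = (Y ^ n).image H.subtype * (R * T) := mul_assoc _ _ _
        _ ⊆ (Y ^ n).image H.subtype * (Y.image H.subtype * R) := Finset.mul_subset_mul_left hRT
        _ = (Y ^ (n + 1)).image H.subtype * R := by
          rw [← mul_assoc, ← Finset.image_mul, ← pow_succ]
  obtain ⟨b, hb, rfl⟩ := exists_sq_eq_of_one_lt hc
  obtain ⟨n, hn, hYn⟩ := h Y b hb
  obtain ⟨k, hk, hkR⟩ := exists_mul_pow_le_pow (one_lt_pow₀ hb hn.ne') R.card 0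
  refine ⟨n * k, by positivity, ?_⟩
  have h1 : ((T ^ (n * k)).card : ℝ) ≤ (Y ^ n).card ^ k * R.card := by
    have h2 := Finset.card_le_card (hTn (n * k))
    have h3 := h2.trans Finset.card_mul_le
    have h4 : ((Y ^ (n * k)).image H.subtype).card ≤ (Y ^ n).card ^ k :=
      Finset.card_image_le.trans (by rw [pow_mul]; exact Finset.card_pow_le)
    exact_mod_cast h3.trans (Nat.mul_le_mul_right _ h4)
  calc ((T ^ (n * k)).card : ℝ) ≤ (Y ^ n).card ^ k * R.card := h1
    _ ≤ (b ^ n) ^ k * (b ^ n) ^ k := by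
      have hkR' : (R.card : ℝ) ≤ (b ^ n) ^ k := by simpa using hkR
      have hYn' : ((Y ^ n).card : ℝ) ≤ b ^ n := by convert hYn <;> rfl
      exact mul_le_mul (pow_le_pow_left₀ (by positivity) hYn' k) hkR' (by positivity)
        (by positivity)
    _ = (b * b) ^ (n * k) := by rw [← pow_mul, mul_pow]

lemma card_pow_le_of_comm {A : Type*} [CommGroup A] [DecidableEq A] (F : Finset A) (k : ℕ) :
    (F ^ k).card ≤ (k + 1) ^ F.card := by
  have : F ^ k ⊆ (Fintype.piFinset fun _ : F => Finset.range (k + 1)).image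
      fun e => ∏ a : F, (a : A) ^ e a := by
    intro x hx
    obtain ⟨f, rfl⟩ := Finset.mem_pow.1 hx
    refine Finset.mem_image.2 ⟨fun a => (Finset.univ.filter fun i => f i = a).card, ?_, ?_⟩
    · refine Fintype.mem_piFinset.2 fun a => Finset.mem_range.2 (Nat.lt_succ_of_le ?_)
      exact (Finset.card_le_univ _).trans (by simp)
    · rw [List.prod_ofFn, ← Finset.prod_fiberwise Finset.univ f]
      refine Finset.prod_congr rfl fun a _ => ?_
      rw [Finset.prod_congr rfl (g := fun _ => (a : A))]
      · simp
      · intro i hi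
        rw [(Finset.mem_filter.1 hi).2]
  refine (Finset.card_le_card this).trans (Finset.card_image_le.trans ?_)
  simp

theorem SubexponentialGrowth.of_ker_le_center {Q : Type*} [Group Q] (f : G →* Q)
    (hf : f.ker ≤ Subgroup.center G) (h : SubexponentialGrowth Q) : SubexponentialGrowth G := by
  classical
  intro T c hc
  obtain ⟨b, hb, rfl⟩ := exists_sq_eq_of_one_lt hc
  obtain ⟨n, hn, hQn⟩ := h (T.image f) b hb
  let σ : Q → G := Function.invFunOn f ((T ^ n : Finset G) : Set G)
  have hσ : ∀ g ∈ T ^ n, f (σ (f g)) = f g := fun g hg =>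
    Function.invFunOn_eq (f := f) ⟨g, hg, rfl⟩
  let Z : G → Subgroup.center G := fun g =>
    if hg : g ∈ T ^ n then ⟨(σ (f g))⁻¹ * g, hf (by simp [MonoidHom.mem_ker, hσ g hg])⟩ else 1
  let F : Finset (Subgroup.center G) := (T ^ n).image Z
  let P : Finset G := ((T ^ n).image f).image σ
  have hsub : T ^ n ⊆ P * F.image (Subgroup.center G).subtype := by
    intro g hg
    refine Finset.mem_mul.2 ⟨σ (f g), Finset.mem_image_of_mem _ (Finset.mem_image_of_mem _ hg),
      (σ (f g))⁻¹ * g, Finset.mem_image.2 ⟨Z g, Finset.mem_image_of_mem _ hg, ?_⟩, by simp⟩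
    simp [Z, hg]
  have hcomm : Commute P (F.image (Subgroup.center G).subtype) := by
    refine Finset.ext fun x => ?_
    simp only [Finset.mem_mul, Finset.mem_image]
    constructor
    · rintro ⟨a, ha, _, ⟨z, hz, rfl⟩, rfl⟩
      exact ⟨_, ⟨z, hz, rfl⟩, a, ha, (Subgroup.mem_center_iff.1 z.2 a).symm⟩
    · rintro ⟨_, ⟨z, hz, rfl⟩, a, ha, rfl⟩
      exact ⟨a, ha, _, ⟨z, hz, rfl⟩, Subgroup.mem_center_iff.1 z.2 a⟩
  have hpow : ∀ k, ((T ^ (n * k)).card : ℝ) ≤ (b ^ n) ^ k * (k + 1 : ℝ) ^ F.card := by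
    intro k
    have h1 : T ^ (n * k) ⊆ P ^ k * (F ^ k).image (Subgroup.center G).subtype := by
      rw [pow_mul, Finset.image_pow, ← hcomm.mul_pow]
      exact Finset.pow_subset_pow_left hsub
    have h2 := (Finset.card_le_card h1).trans Finset.card_mul_le
    have h3 : (P ^ k).card ≤ ((T.image f) ^ n).card ^ k := by
      refine Finset.card_pow_le.trans (Nat.pow_le_pow_left ?_ k)
      rw [← Finset.image_pow]
      exact Finset.card_image_le
    have h4 : ((F ^ k).image (Subgroup.center G).subtype).card ≤ (k + 1) ^ F.card :=
      Finset.card_image_le.trans (by convert card_pow_le_of_comm F k)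
    calc ((T ^ (n * k)).card : ℝ)
        ≤ (((T.image f) ^ n).card ^ k * (k + 1) ^ F.card : ℕ) :=
          Nat.cast_le.2 (h2.trans (Nat.mul_le_mul h3 h4))
      _ = (((T.image f) ^ n).card : ℝ) ^ k * (k + 1 : ℝ) ^ F.card := by push_cast; rfl
      _ ≤ _ := by gcongr
  obtain ⟨k, hk, hkF⟩ := exists_mul_pow_le_pow (one_lt_pow₀ hb hn.ne') 1 F.card
  refine ⟨n * k, by positivity, (hpow k).trans ?_⟩
  rw [one_mul] at hkF
  calc (b ^ n) ^ k * (k + 1 : ℝ) ^ F.card ≤ (b ^ n) ^ k * (b ^ n) ^ k := by gcongr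
    _ = (b * b) ^ (n * k) := by rw [← pow_mul, mul_pow]

theorem SubexponentialGrowth.of_isNilpotent [Group.IsNilpotent G] : SubexponentialGrowth G := by
  classical
  refine Group.nilpotent_center_quotient_ind (P := fun G _ _ => SubexponentialGrowth G) G ?_ ?_
  · intro G _ _ T c hc
    refine ⟨1, one_pos, ?_⟩
    exact (Nat.cast_le.2 (Finset.card_le_one_of_subsingleton _)).trans (by simpa using hc.le)
  · intro G _ _ h
    exact h.of_ker_le_center (QuotientGroup.mk' (Subgroup.center G)) (by simp)

theorem SubexponentialGrowth.not_hasExponentialGrowth (h : SubexponentialGrowth G) :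
    ¬ HasExponentialGrowth G := by
  classical
  rintro ⟨X, -, hX⟩
  obtain ⟨T, -, hT⟩ := growthFn_eq_card X
  obtain ⟨c, hc1, hc⟩ := exists_between hX
  obtain ⟨n, hn, hcard⟩ := h T c hc1
  obtain ⟨n, rfl⟩ := Nat.exists_eq_succ_of_ne_zero hn.ne'
  have h1 : growthRateX X ≤ (growthFn X (n + 1) : ℝ) ^ ((1 : ℝ) / (n + 1)) :=
    ciInf_le ⟨0, by rintro _ ⟨m, rfl⟩; positivity⟩ n
  have h2 : (growthFn X (n + 1) : ℝ) ^ ((1 : ℝ) / (n + 1)) ≤ c := by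
    rw [hT]
    calc (((T ^ (n + 1)).card : ℝ)) ^ ((1 : ℝ) / (n + 1))
        ≤ (c ^ (n + 1)) ^ ((1 : ℝ) / (n + 1)) :=
          Real.rpow_le_rpow (by positivity) (by convert hcard) (by positivity)
      _ = c := by
        rw [← Real.rpow_natCast, ← Real.rpow_mul (by linarith)]
        push_cast
        rw [mul_one_div_cancel (by positivity), Real.rpow_one]
  linarith

end Subexponential

section Kronecker

open Polynomial

variable {R : Type*} [CommRing R] [IsDomain R]

lemma mahlerMeasure_le_one_of_roots {p : ℤ[X]} (hp : p.Monic)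
    (h : ∀ z ∈ (p.map (Int.castRingHom ℂ)).roots, ‖z‖ ≤ 1) :
    (p.map (Int.castRingHom ℂ)).mahlerMeasure ≤ 1 := by
  rw [mahlerMeasure_eq_leadingCoeff_mul_prod_roots, (hp.map _).leadingCoeff, norm_one, one_mul]
  refine le_of_eq (Multiset.prod_eq_one fun a ha => ?_)
  obtain ⟨z, hz, rfl⟩ := Multiset.mem_map.1 ha
  exact max_eq_left (h z hz)

lemma finite_isOfFinOrder_of_natDegree_minpoly_le [Module.IsTorsionFree ℤ R] (d : ℕ) :
    {x : R | (∃ n : ℕ, 0 < n ∧ x ^ n = 1) ∧ (minpoly ℤ x).natDegree ≤ d}.Finite := by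
  refine ((finite_mahlerMeasure_le d 1).biUnion (t := fun p => {x : R | p ≠ 0 ∧ aeval x p = 0})
    fun p _ => ?_).subset ?_
  · refine (Polynomial.rootSet_finite p R).subset ?_
    rintro x ⟨hp, hx⟩
    exact (mem_rootSet_of_injective (FaithfulSMul.algebraMap_injective ℤ R) hp).2 hx
  · rintro x ⟨⟨n, hn, hx⟩, hd⟩
    have hann : aeval x (X ^ n - 1 : ℤ[X]) = 0 := by simp [hx]
    have hint : IsIntegral ℤ x := ⟨X ^ n - 1, monic_X_pow_sub_C 1 hn.ne', hann⟩
    refine Set.mem_biUnion ⟨hd, ?_⟩ ⟨minpoly.ne_zero hint, minpoly.aeval ℤ x⟩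
    rw [NNReal.coe_one]
    refine mahlerMeasure_le_one_of_roots (minpoly.monic hint) fun z hz => ?_
    have hz0 : aeval z (minpoly ℤ x) = 0 := by
      rw [aeval_def, ← eval_map]
      exact isRoot_of_mem_roots hz
    have := aeval_eq_zero_of_dvd_aeval_eq_zero (minpoly.isIntegrallyClosed_dvd hint hann) hz0
    have hz1 : z ^ n = 1 := by simpa [sub_eq_zero] using this
    exact (Complex.norm_eq_one_of_pow_eq_one hz1 hn.ne').le

lemma exists_mahlerMeasure_gap (d : ℕ) : ∃ c : ℝ, 1 < c ∧ ∀ p : ℤ[X], p.natDegree ≤ d →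
    (p.map (Int.castRingHom ℂ)).mahlerMeasure < c →
      (p.map (Int.castRingHom ℂ)).mahlerMeasure ≤ 1 := by
  set F := {p : ℤ[X] | p.natDegree ≤ d ∧
    (p.map (Int.castRingHom ℂ)).mahlerMeasure ≤ (2 : NNReal)} ∩
    {p | 1 < (p.map (Int.castRingHom ℂ)).mahlerMeasure} with hF
  have hfin : F.Finite := (finite_mahlerMeasure_le d 2).inter_of_left _
  have key : ∃ c : ℝ, 1 < c ∧ c ≤ 2 ∧
      ∀ p ∈ F, c ≤ (p.map (Int.castRingHom ℂ)).mahlerMeasure := by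
    rcases F.eq_empty_or_nonempty with h | h
    · exact ⟨2, one_lt_two, le_rfl, by simp [h]⟩
    · obtain ⟨p, hp, hmin⟩ := hfin.exists_minimalFor
        (fun p : ℤ[X] => (p.map (Int.castRingHom ℂ)).mahlerMeasure) F h
      exact ⟨_, hp.2, hp.1.2, fun q hq => le_of_not_gt fun hlt => (hmin hq hlt.le).not_gt hlt⟩
  obtain ⟨c, hc1, hc2, hc⟩ := key
  refine ⟨c, hc1, fun p hp hlt => le_of_not_gt fun h1 => ?_⟩
  exact (hc p ⟨⟨hp, (hlt.le.trans hc2)⟩, h1⟩).not_gt hlt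

lemma pow_eq_one_of_mahlerMeasure_minpoly {x : R} (hx0 : x ≠ 0) (hx : IsIntegral ℤ x)
    (h : ((minpoly ℤ x).map (Int.castRingHom ℂ)).mahlerMeasure = 1) :
    ∃ n : ℕ, 0 < n ∧ x ^ n = 1 := by
  have hdeg : ((minpoly ℤ x).map (Int.castRingHom ℂ)).degree ≠ 0 := by
    rw [(minpoly.monic hx).degree_map]
    exact (minpoly.degree_pos hx).ne'
  obtain ⟨z, hz⟩ := IsAlgClosed.exists_root _ hdeg
  have hz' : aeval z (minpoly ℤ x) = 0 := by
    rw [aeval_def, ← eval_map]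
    exact hz
  have hzint : IsIntegral ℤ z := ⟨_, minpoly.monic hx, hz'⟩
  have heq : minpoly ℤ z = minpoly ℤ x := by
    refine eq_of_monic_of_associated (minpoly.monic hzint) (minpoly.monic hx) ?_
    exact (minpoly.irreducible hzint).associated_of_dvd (minpoly.irreducible hx)
      (minpoly.isIntegrallyClosed_dvd hzint hz')
  have hz0 : z ≠ 0 := by
    rintro rfl
    have hdvd : minpoly ℤ (0 : ℂ) ∣ X := minpoly.isIntegrallyClosed_dvd hzint (by simp)
    have := aeval_eq_zero_of_dvd_aeval_eq_zero (heq ▸ hdvd) (minpoly.aeval ℤ x)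
    exact hx0 (by simpa using this)
  obtain ⟨n, hn, hzn⟩ := pow_eq_one_of_mahlerMeasure_eq_one h hz0
    (mem_aroots.2 ⟨minpoly.ne_zero hx, hz'⟩)
  refine ⟨n, hn, ?_⟩
  have hdvd : minpoly ℤ z ∣ X ^ n - 1 :=
    minpoly.isIntegrallyClosed_dvd hzint (by simp [hzn])
  have := aeval_eq_zero_of_dvd_aeval_eq_zero (heq ▸ hdvd) (minpoly.aeval ℤ x)
  simpa [sub_eq_zero] using this

/-- A uniform version of Kronecker's theorem: an algebraic integer of degree at most `d` that is
not a root of unity has a conjugate whose `k`-th power has absolute value at least two, with `k`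
depending only on `d`. -/
theorem exists_root_two_le_norm_pow (d : ℕ) : ∃ k : ℕ, 0 < k ∧
    ∀ {R : Type*} [CommRing R] [IsDomain R] (x : R), x ≠ 0 →
      IsIntegral ℤ x → (minpoly ℤ x).natDegree ≤ d → (∀ n : ℕ, 0 < n → x ^ n ≠ 1) →
      ∃ z : ℂ, aeval z (minpoly ℤ x) = 0 ∧ 2 ≤ ‖z‖ ^ k := by
  obtain ⟨c, hc, hgap⟩ := exists_mahlerMeasure_gap d
  obtain ⟨k, hk⟩ := pow_unbounded_of_one_lt ((2 : ℝ) ^ d) hc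
  refine ⟨k + 1, k.succ_pos, fun {R} _ _ x hx0 hx hd hord => ?_⟩
  set p := (minpoly ℤ x).map (Int.castRingHom ℂ) with hp
  have hmon : p.Monic := (minpoly.monic hx).map _
  have hcp : c ≤ p.mahlerMeasure := by
    by_contra! hlt
    obtain ⟨n, hn, hxn⟩ := pow_eq_one_of_mahlerMeasure_minpoly hx0 hx
      ((hgap _ hd hlt).antisymm (one_le_mahlerMeasure_of_ne_zero (minpoly.ne_zero hx)))
    exact hord n hn hxn
  by_contra! hz
  have hroot : ∀ z ∈ p.roots, (max 1 ‖z‖) ^ (k + 1) ≤ 2 := by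
    intro z hzr
    rcases max_cases 1 ‖z‖ with ⟨h, -⟩ | ⟨h, -⟩ <;> rw [h]
    · simp
    · refine (hz z ?_).le
      rw [aeval_def, ← eval_map]
      exact isRoot_of_mem_roots hzr
  have hle : p.mahlerMeasure ^ (k + 1) ≤ 2 ^ d := by
    rw [mahlerMeasure_eq_leadingCoeff_mul_prod_roots, hmon.leadingCoeff, norm_one, one_mul,
      ← Multiset.prod_map_pow]
    have h1 : (p.roots.map fun z => (max 1 ‖z‖) ^ (k + 1)).prod ≤
        (p.roots.map fun _ => (2 : ℝ)).prod :=
      Multiset.prod_map_le_prod_map₀ _ _ (fun z _ => by positivity) hroot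
    refine h1.trans ?_
    rw [Multiset.map_const', Multiset.prod_replicate]
    refine pow_le_pow_right₀ one_le_two ((card_roots' p).trans ?_)
    exact natDegree_map_le.trans hd
  have h2 : c ^ k ≤ p.mahlerMeasure ^ (k + 1) :=
    (pow_le_pow_right₀ hc.le k.le_succ).trans (pow_le_pow_left₀ (by linarith) hcp _)
  linarith

/-- The polynomial in `X ^ k` whose coefficients are the digits `l`. -/
noncomputable def digitPoly (k : ℕ) : List Bool → ℤ[X]
  | [] => 0
  | b :: l => cond b 0 1 + X ^ k * digitPoly k l

lemma aeval_digitPoly_cons {A : Type*} [Ring A] (x : A) (k : ℕ) (b : Bool) (l : List Bool) :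
    aeval x (digitPoly k (b :: l)) = cond b 0 1 + x ^ k * aeval x (digitPoly k l) := by
  cases b <;> simp [digitPoly]

lemma one_le_norm_aeval_digitPoly_sub {z : ℂ} {k : ℕ} (hz : 2 ≤ ‖z‖ ^ k) :
    ∀ {l l' : List Bool}, l.length = l'.length → l ≠ l' →
      1 ≤ ‖aeval z (digitPoly k l) - aeval z (digitPoly k l')‖
  | [], [], _, h => absurd rfl h
  | b :: l, b' :: l', hlen, hne => by
    have e : aeval z (digitPoly k (b :: l)) - aeval z (digitPoly k (b' :: l')) =
        (cond b 0 1 - cond b' 0 1 : ℂ) +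
          z ^ k * (aeval z (digitPoly k l) - aeval z (digitPoly k l')) := by
      rw [aeval_digitPoly_cons, aeval_digitPoly_cons]
      ring
    rw [e]
    by_cases hl : l = l'
    · subst hl
      have hb : b ≠ b' := fun h => hne (by rw [h])
      cases b <;> cases b' <;> simp_all
    · have ih := one_le_norm_aeval_digitPoly_sub hz (by simpa using hlen) hl
      have hcond : ‖(cond b 0 1 - cond b' 0 1 : ℂ)‖ ≤ 1 := by
        cases b <;> cases b' <;> simp
      have h2 : 2 ≤ ‖z ^ k * (aeval z (digitPoly k l) - aeval z (digitPoly k l'))‖ := by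
        rw [norm_mul, norm_pow]
        nlinarith
      have h3 := norm_sub_le_norm_add
        (z ^ k * (aeval z (digitPoly k l) - aeval z (digitPoly k l')))
        (cond b 0 1 - cond b' 0 1 : ℂ)
      rw [add_comm]
      linarith

/-- Digit expansions in an algebraic integer with a large conjugate are unique. -/
theorem digitPoly_injective [Module.IsTorsionFree ℤ R] {x : R} (hx : IsIntegral ℤ x) {z : ℂ} {k : ℕ}
    (hz0 : aeval z (minpoly ℤ x) = 0) (hz : 2 ≤ ‖z‖ ^ k) {l l' : List Bool}
    (hlen : l.length = l'.length)
    (h : aeval x (digitPoly k l) = aeval x (digitPoly k l')) : l = l' := by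
  by_contra hne
  have h1 : aeval z (digitPoly k l - digitPoly k l') = 0 :=
    aeval_eq_zero_of_dvd_aeval_eq_zero
      (minpoly.isIntegrallyClosed_dvd hx (by rw [map_sub, h, sub_self])) hz0
  have h2 := one_le_norm_aeval_digitPoly_sub hz hlen hne
  rw [← map_sub, h1, norm_zero] at h2
  linarith

end Kronecker

section IrreducibleCommutingEndomorphisms

open Polynomial
open scoped IsMulCommutative

variable {M : Type*} [AddCommGroup M]

lemma isDomain_adjoin_of_commutant [Nontrivial M] {S : Set (Module.End ℤ M)}
    (hS : ∀ a ∈ S, ∀ b ∈ S, a * b = b * a)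
    (hirr : ∀ φ : Module.End ℤ M, (∀ a ∈ S, φ * a = a * φ) → φ = 0 ∨ Function.Injective φ) :
    IsDomain (Algebra.adjoin ℤ S) := by
  have hcomm : IsMulCommutative (Algebra.adjoin ℤ S) := Algebra.isMulCommutative_adjoin ℤ hS
  have hle : Algebra.adjoin ℤ S ≤ Subalgebra.centralizer ℤ S :=
    Algebra.adjoin_le fun a ha => (Subalgebra.mem_centralizer_iff ℤ).2 fun b hb => hS b hb a ha
  have : NoZeroDivisors (Algebra.adjoin ℤ S) := by
    refine ⟨fun {a b} hab => or_iff_not_imp_left.2 fun ha => ?_⟩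
    have hinj := (hirr a fun s hs => ((Subalgebra.mem_centralizer_iff ℤ).1 (hle a.2) s hs).symm)
      |>.resolve_left fun h => ha (Subtype.ext h)
    refine Subtype.ext (LinearMap.ext fun m => hinj ?_)
    have := congrArg (fun c : Algebra.adjoin ℤ S => (c : Module.End ℤ M) m) hab
    simpa using this
  exact NoZeroDivisors.to_isDomain _

variable [Module.Free ℤ M] [Module.Finite ℤ M]

lemma aeval_charpoly_subalgebra {R : Subalgebra ℤ (Module.End ℤ M)} (x : R) :
    aeval x (x : Module.End ℤ M).charpoly = 0 :=
  Subtype.ext <| by rw [aeval_subalgebra_coe, LinearMap.aeval_self_charpoly]; rfl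

lemma isIntegral_subalgebra_end {R : Subalgebra ℤ (Module.End ℤ M)} (x : R) : IsIntegral ℤ x :=
  ⟨_, LinearMap.charpoly_monic _, aeval_charpoly_subalgebra x⟩

lemma natDegree_minpoly_subalgebra_end_le {R : Subalgebra ℤ (Module.End ℤ M)} (x : R) :
    (minpoly ℤ x).natDegree ≤ Module.finrank ℤ M := by
  rw [← LinearMap.charpoly_natDegree (x : Module.End ℤ M)]
  exact natDegree_le_natDegree
    (minpoly.min ℤ x (LinearMap.charpoly_monic _) (aeval_charpoly_subalgebra x))

lemma finite_isOfFinOrder_of_commutant [Nontrivial M] {S : Set (Module.End ℤ M)}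
    (hS : ∀ a ∈ S, ∀ b ∈ S, a * b = b * a)
    (hirr : ∀ φ : Module.End ℤ M, (∀ a ∈ S, φ * a = a * φ) → φ = 0 ∨ Function.Injective φ) :
    {x ∈ S | IsOfFinOrder x}.Finite := by
  have hcomm : IsMulCommutative (Algebra.adjoin ℤ S) := Algebra.isMulCommutative_adjoin ℤ hS
  have := isDomain_adjoin_of_commutant hS hirr
  refine ((finite_isOfFinOrder_of_natDegree_minpoly_le (R := Algebra.adjoin ℤ S)
    (Module.finrank ℤ M)).image Subtype.val).subset ?_
  rintro x ⟨hx, hfin⟩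
  obtain ⟨n, hn, hxn⟩ := isOfFinOrder_iff_pow_eq_one.1 hfin
  exact ⟨⟨x, Algebra.subset_adjoin hx⟩, ⟨⟨n, hn, Subtype.ext hxn⟩,
    natDegree_minpoly_subalgebra_end_le _⟩, rfl⟩

variable (M) in
/-- The exponent `k` for which the digit expansions in `x ^ k` are unique depends only on the
module. -/
theorem exists_digitPoly_exponent [Nontrivial M] : ∃ k : ℕ, ∀ S : Set (Module.End ℤ M),
    (∀ a ∈ S, ∀ b ∈ S, a * b = b * a) →
    (∀ φ : Module.End ℤ M, (∀ a ∈ S, φ * a = a * φ) → φ = 0 ∨ Function.Injective φ) →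
    ∀ x ∈ S, x ≠ 0 → ¬ IsOfFinOrder x → ∀ m : M, m ≠ 0 → ∀ l l' : List Bool,
      l.length = l'.length → aeval x (digitPoly k l) m = aeval x (digitPoly k l') m →
      l = l' := by
  obtain ⟨k, -, hk⟩ := exists_root_two_le_norm_pow (Module.finrank ℤ M)
  refine ⟨k, fun S hS hirr x hx hx0 hord m hm l l' hlen heq => ?_⟩
  have hcomm : IsMulCommutative (Algebra.adjoin ℤ S) := Algebra.isMulCommutative_adjoin ℤ hS
  have := isDomain_adjoin_of_commutant hS hirr
  have hle : Algebra.adjoin ℤ S ≤ Subalgebra.centralizer ℤ S :=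
    Algebra.adjoin_le fun a ha => (Subalgebra.mem_centralizer_iff ℤ).2 fun b hb => hS b hb a ha
  let y : Algebra.adjoin ℤ S := ⟨x, Algebra.subset_adjoin hx⟩
  obtain ⟨z, hz0, hz⟩ := hk y (fun h => hx0 (congrArg Subtype.val h))
    (isIntegral_subalgebra_end y) (natDegree_minpoly_subalgebra_end_le y)
    fun n hn h => hord (isOfFinOrder_iff_pow_eq_one.2 ⟨n, hn, congrArg Subtype.val h⟩)
  refine digitPoly_injective (isIntegral_subalgebra_end y) hz0 hz hlen (Subtype.ext ?_)
  set δ := aeval y (digitPoly k l) - aeval y (digitPoly k l') with hδ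
  have hδm : (δ : Module.End ℤ M) m = 0 := by
    rw [hδ, Subalgebra.coe_sub, LinearMap.sub_apply, aeval_subalgebra_coe, aeval_subalgebra_coe]
    exact sub_eq_zero.2 heq
  rcases hirr δ fun s hs => ((Subalgebra.mem_centralizer_iff ℤ).1 (hle δ.2) s hs).symm with h | h
  · rw [hδ, Subalgebra.coe_sub, sub_eq_zero] at h
    exact h
  · exact absurd (h (hδm.trans (map_zero _).symm)) hm

end IrreducibleCommutingEndomorphisms

section ShortCommutators

open scoped Pointwise commutatorElement

variable {G : Type*} [Group G]

/-- Left-normed commutators of weight `n + 1` with entries in `S`. -/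
def leftNormedCommutators (S : Set G) : ℕ → Set G
  | 0 => S
  | n + 1 => {g | ∃ s ∈ leftNormedCommutators S n, ∃ y ∈ S, g = ⁅s, y⁆}

lemma leftNormedCommutators_subset_unitBall_pow (S : Set G) (n : ℕ) :
    leftNormedCommutators S n ⊆ unitBall S ^ 4 ^ n := by
  induction n with
  | zero => simpa [leftNormedCommutators] using subset_unitBall S
  | succ n ih =>
    rintro _ ⟨s, hs, y, hy, rfl⟩
    have hs' := ih hs
    have hy' : y ∈ unitBall S ^ 4 ^ n := by
      refine unitBall_pow_mono S (m := 1) (Nat.one_le_pow _ _ (by norm_num)) ?_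
      simpa using subset_unitBall S hy
    rw [show 4 ^ (n + 1) = 4 ^ n + 4 ^ n + 4 ^ n + 4 ^ n by ring, pow_add, pow_add, pow_add]
    exact Set.mul_mem_mul (Set.mul_mem_mul (Set.mul_mem_mul hs' hy') (inv_mem_unitBall_pow hs'))
      (inv_mem_unitBall_pow hy')

lemma leftNormedCommutators_subset_lowerCentralSeries (S : Set G) (n : ℕ) :
    leftNormedCommutators S n ⊆ (⊤ : Subgroup G).lowerCentralSeries n := by
  induction n with
  | zero => simp
  | succ n ih =>
    rintro _ ⟨s, hs, y, -, rfl⟩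
    exact Subgroup.commutator_mem_commutator (ih hs) (Subgroup.mem_top y)

lemma leftNormedCommutators_image {H : Type*} [Group H] (f : G →* H) (S : Set G) (n : ℕ) :
    leftNormedCommutators (f '' S) n = f '' leftNormedCommutators S n := by
  induction n with
  | zero => rfl
  | succ n ih =>
    ext x
    simp only [leftNormedCommutators, ih]
    constructor
    · rintro ⟨_, ⟨s, hs, rfl⟩, _, ⟨y, hy, rfl⟩, rfl⟩
      exact ⟨_, ⟨s, hs, y, hy, rfl⟩, map_commutatorElement f s y⟩
    · rintro ⟨_, ⟨s, hs, y, hy, rfl⟩, rfl⟩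
      exact ⟨_, ⟨s, hs, rfl⟩, _, ⟨y, hy, rfl⟩, map_commutatorElement f s y⟩

lemma mem_center_of_forall_commute {S : Set G} (hS : Subgroup.closure S = ⊤) {g : G}
    (h : ∀ y ∈ S, ⁅g, y⁆ = 1) : g ∈ Subgroup.center G := by
  rw [← Subgroup.centralizer_univ, ← Subgroup.coe_top, ← hS, Subgroup.centralizer_closure]
  exact Subgroup.mem_centralizer_iff.2 fun y hy =>
    (commutatorElement_eq_one_iff_mul_comm.1 (h y hy)).symm

theorem isNilpotent_of_leftNormedCommutators_eq_one (n : ℕ) {G : Type*} [Group G] {S : Set G}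
    (hS : Subgroup.closure S = ⊤) (h : ∀ s ∈ leftNormedCommutators S n, s = 1) :
    Group.IsNilpotent G := by
  induction n generalizing G with
  | zero =>
    have : Subsingleton G := by
      rw [← Subgroup.subsingleton_iff, ← subsingleton_iff_bot_eq_top, ← hS, eq_comm,
        Subgroup.closure_eq_bot_iff]
      exact h
    infer_instance
  | succ n ih =>
    refine Group.of_quotient_center_nilpotent
      (ih (S := QuotientGroup.mk' (Subgroup.center G) '' S) ?_ ?_)
    · rw [← MonoidHom.map_closure, hS, Subgroup.map_top_of_surjective _
        (QuotientGroup.mk'_surjective _)]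
    · rw [leftNormedCommutators_image]
      rintro _ ⟨s, hs, rfl⟩
      refine (QuotientGroup.eq_one_iff s).2 (mem_center_of_forall_commute hS fun y hy => ?_)
      exact h _ ⟨s, hs, y, hy, rfl⟩

lemma exists_short_mem_ker {N : Type*} [Group N] [Group.IsNilpotent N] (f : G →* N)
    (hG : ¬ Group.IsNilpotent G) {S : Set G} (hS : Subgroup.closure S = ⊤) :
    ∃ a ∈ f.ker, a ≠ 1 ∧ a ∈ unitBall S ^ 4 ^ Group.nilpotencyClass N := by
  by_contra! h
  refine hG (isNilpotent_of_leftNormedCommutators_eq_one (Group.nilpotencyClass N) hS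
    fun s hs => ?_)
  by_contra hs1
  refine h s ?_ hs1 (leftNormedCommutators_subset_unitBall_pow S _ hs)
  have h1 := Subgroup.mem_map_of_mem f (leftNormedCommutators_subset_lowerCentralSeries S _ hs)
  rw [Subgroup.map_lowerCentralSeries] at h1
  have h2 : f s ∈ (⊤ : Subgroup N).lowerCentralSeries (Group.nilpotencyClass N) :=
    Subgroup.lowerCentralSeries_mono _ le_top h1
  rwa [Subgroup.lowerCentralSeries_nilpotencyClass, Subgroup.mem_bot] at h2

end ShortCommutators

section CommutingAction

open Polynomial
open scoped Pointwise

variable {M : Type*} [AddCommGroup M] {H : Type*} [Group H]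

lemma finiteIndex_ker_of_finite_range (ρ : H →* Module.End ℤ M) (h : (Set.range ρ).Finite) :
    ρ.ker.FiniteIndex := by
  have hker : ρ.ker = ρ.toHomUnits.ker := by
    ext g
    rw [MonoidHom.mem_ker, MonoidHom.mem_ker, Units.ext_iff]
    rfl
  have : Finite ρ.toHomUnits.range := by
    have h1 : (Units.val '' (ρ.toHomUnits.range : Set (Module.End ℤ M)ˣ)).Finite := by
      refine h.subset ?_
      rintro _ ⟨_, ⟨g, rfl⟩, rfl⟩
      exact ⟨g, rfl⟩
    exact h1.of_finite_image Units.val_injective.injOn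
  rw [hker]
  exact Subgroup.finiteIndex_ker _

lemma isOfFinOrder_of_closure (ρ : H →* Module.End ℤ M) (hcomm : ∀ g h, Commute (ρ g) (ρ h))
    {S : Set H} (hS : Subgroup.closure S = ⊤) (h : ∀ s ∈ S, IsOfFinOrder (ρ s)) (g : H) :
    IsOfFinOrder (ρ g) := by
  have hg : g ∈ Subgroup.closure S := hS ▸ Subgroup.mem_top g
  induction hg using Subgroup.closure_induction with
  | mem x hx => exact h x hx
  | one => simp
  | mul x y _ _ hx hy =>
    rw [map_mul]
    exact (hcomm x y).isOfFinOrder_mul hx hy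
  | inv x _ hx =>
    obtain ⟨n, hn, hxn⟩ := isOfFinOrder_iff_pow_eq_one.1 hx
    refine isOfFinOrder_iff_pow_eq_one.2 ⟨n, hn, ?_⟩
    rw [← map_pow] at hxn ⊢
    have h1 : ρ ((x⁻¹) ^ n) * ρ (x ^ n) = 1 := by
      rw [← map_mul, inv_pow, inv_mul_cancel, map_one]
    rwa [hxn, mul_one] at h1

variable {N : Type*} [Group N] [Group.IsNilpotent N] {f : H →* N} {j : Multiplicative M →* H}
  {ρ : H →* Module.End ℤ M}

lemma isNilpotent_ker_of_conj (hf : f.ker ≤ j.range)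
    (hρ : ∀ h m, j (.ofAdd (ρ h m)) = h * j (.ofAdd m) * h⁻¹) : Group.IsNilpotent ρ.ker := by
  refine Subgroup.isNilpotent_of_ker_le_center (f.comp ρ.ker.subtype) fun x hx => ?_
  obtain ⟨m, hm⟩ := hf (show (x : H) ∈ f.ker from hx)
  refine Subgroup.mem_center_iff.2 fun y => Subtype.ext ?_
  have h1 := hρ y m.toAdd
  rw [show ρ y = 1 from y.2, Module.End.one_apply, ofAdd_toAdd, hm] at h1
  exact (eq_mul_inv_iff_mul_eq.1 h1).symm

lemma prod_map_cond_eq (hρ : ∀ h m, j (.ofAdd (ρ h m)) = h * j (.ofAdd m) * h⁻¹)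
    (y : H) (m : M) (k : ℕ) (l : List Bool) :
    (l.map fun b => cond b (y ^ k) (j (.ofAdd m) * y ^ k)).prod =
      j (.ofAdd (aeval (ρ y) (digitPoly k l) m)) * y ^ (k * l.length) := by
  induction l with
  | nil => simp [digitPoly]
  | cons b l ih =>
    have h1 : y ^ k * j (.ofAdd (aeval (ρ y) (digitPoly k l) m)) =
        j (.ofAdd ((ρ y ^ k) (aeval (ρ y) (digitPoly k l) m))) * y ^ k := by
      rw [← map_pow, hρ, inv_mul_cancel_right]
    rw [List.map_cons, List.prod_cons, ih, aeval_digitPoly_cons, List.length_cons,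
      show k * (l.length + 1) = k + k * l.length by ring, pow_add, ← mul_assoc, ← mul_assoc]
    congr 1
    cases b
    · rw [cond_false, cond_false, mul_assoc, h1, ← mul_assoc, ← map_mul, ← ofAdd_add]
      rfl
    · rw [cond_true, cond_true, h1, zero_add]
      rfl

theorem uniformlyFreeSemigroup_of_commute_action [Module.Free ℤ M] [Module.Finite ℤ M]
    [Nontrivial M] (hj : Function.Injective j) (hf : f.ker ≤ j.range)
    (hρ : ∀ h m, j (.ofAdd (ρ h m)) = h * j (.ofAdd m) * h⁻¹)
    (hcomm : ∀ g h, Commute (ρ g) (ρ h))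
    (hirr : ∀ φ : Module.End ℤ M, (∀ h, Commute φ (ρ h)) → φ = 0 ∨ Function.Injective φ)
    (hvn : ¬ Group.IsVirtuallyNilpotent H) : UniformlyFreeSemigroup H := by
  have hS : ∀ a ∈ Set.range ρ, ∀ b ∈ Set.range ρ, a * b = b * a := by
    rintro _ ⟨g, rfl⟩ _ ⟨h, rfl⟩
    exact hcomm g h
  have hirr' : ∀ φ : Module.End ℤ M, (∀ a ∈ Set.range ρ, φ * a = a * φ) →
      φ = 0 ∨ Function.Injective φ := fun φ hφ => hirr φ fun h => hφ _ ⟨h, rfl⟩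
  obtain ⟨k, hk⟩ := exists_digitPoly_exponent M
  refine ⟨4 ^ Group.nilpotencyClass N + k, fun Y hY => ?_⟩
  obtain ⟨y, hy, hord⟩ : ∃ y ∈ Y, ¬ IsOfFinOrder (ρ y) := by
    by_contra! h
    refine hvn ⟨ρ.ker, isNilpotent_ker_of_conj hf hρ, finiteIndex_ker_of_finite_range ρ ?_⟩
    refine (finite_isOfFinOrder_of_commutant hS hirr').subset ?_
    rintro _ ⟨g, rfl⟩
    exact ⟨⟨g, rfl⟩, isOfFinOrder_of_closure ρ hcomm hY h g⟩
  obtain ⟨a, ha, ha1, haY⟩ :=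
    exists_short_mem_ker f (fun h => hvn h.isVirtuallyNilpotent) hY
  obtain ⟨m, rfl⟩ := hf ha
  have hm : m.toAdd ≠ 0 := fun h => ha1 (by rw [show m = 1 from h, map_one])
  have hyk : y ^ k ∈ unitBall Y ^ k := Set.pow_mem_pow (subset_unitBall Y hy)
  refine ⟨y ^ k, unitBall_pow_mono Y (Nat.le_add_left _ _) hyk, j m * y ^ k, ?_, ?_⟩
  · rw [pow_add]
    exact Set.mul_mem_mul haY hyk
  · intro l l' hlen heq
    have hy0 : ρ y ≠ 0 := fun h => by
      have : ρ y * ρ y⁻¹ = 1 := by rw [← map_mul, mul_inv_cancel, map_one]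
      rw [h, zero_mul] at this
      exact zero_ne_one this
    refine hk _ hS hirr' (ρ y) ⟨y, rfl⟩ hy0 hord m.toAdd hm l l' hlen ?_
    have h1 := prod_map_cond_eq hρ y m.toAdd k l
    have h2 := prod_map_cond_eq hρ y m.toAdd k l'
    rw [ofAdd_toAdd] at h1 h2
    rw [h1, h2, hlen] at heq
    exact Multiplicative.ofAdd.injective (hj (mul_right_cancel heq))

end CommutingAction

section VirtuallyNilpotent

variable {G : Type*} [Group G]

lemma Subgroup.finiteIndex_map_subtype {H : Subgroup G} [hH : H.FiniteIndex] {K : Subgroup H}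
    (hK : K.FiniteIndex) : (K.map H.subtype).FiniteIndex := by
  refine ⟨?_⟩
  rw [Subgroup.index_map_subtype]
  exact mul_ne_zero hK.index_ne_zero hH.index_ne_zero

lemma Group.IsVirtuallyNilpotent.of_finiteIndex {H : Subgroup G} [H.FiniteIndex]
    (h : Group.IsVirtuallyNilpotent H) : Group.IsVirtuallyNilpotent G := by
  obtain ⟨K, hK, hfin⟩ := h
  refine ⟨K.map H.subtype, ?_, Subgroup.finiteIndex_map_subtype hfin⟩
  exact Group.nilpotent_of_mulEquiv (K.equivMapOfInjective H.subtype H.subtype_injective)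

end VirtuallyNilpotent

section NilpotentAction

open Polynomial
open scoped IsMulCommutative commutatorElement

variable {M : Type*} [AddCommGroup M]

lemma finite_of_forall_aeval_mul_eq_zero [Nontrivial M] {T : Set (Module.End ℤ M)}
    {z : Module.End ℤ M} {p : ℤ[X]} (hp : p.Monic) (hz : IsUnit z)
    (hT : ∀ a ∈ T, ∀ b ∈ T, a * b = b * a) (hTz : ∀ a ∈ T, a * z = z * a)
    (hinj : ∀ a ∈ T, ∀ b ∈ T, a ≠ b → Function.Injective (a - b : Module.End ℤ M))
    (hroot : ∀ a ∈ T, aeval (a * z) p = 0) : T.Finite := by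
  by_contra hinf
  have : Infinite T := Set.infinite_coe_iff.2 hinf
  let t : ℕ ↪ T := Infinite.natEmbedding T
  have hS : ∀ a ∈ insert z T, ∀ b ∈ insert z T, a * b = b * a := by
    rintro a (rfl | ha) b (rfl | hb)
    · rfl
    · exact (hTz b hb).symm
    · exact hTz a ha
    · exact hT a ha b hb
  have hcomm : IsMulCommutative (Algebra.adjoin ℤ (insert z T)) :=
    Algebra.isMulCommutative_adjoin ℤ hS
  let v : Fin (p.natDegree + 1) → Algebra.adjoin ℤ (insert z T) := fun i =>
    ⟨t i, Algebra.subset_adjoin (Set.mem_insert_of_mem _ (t i).2)⟩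
  let y : Algebra.adjoin ℤ (insert z T) := ⟨z, Algebra.subset_adjoin (Set.mem_insert _ _)⟩
  let c : Fin (p.natDegree + 1) → Algebra.adjoin ℤ (insert z T) := fun i => p.coeff i • y ^ (i : ℕ)
  have hdet : (Matrix.vandermonde v).det ∈ nonZeroDivisors (Algebra.adjoin ℤ (insert z T)) := by
    rw [Matrix.det_vandermonde]
    refine Submonoid.prod_mem _ fun i _ => Submonoid.prod_mem _ fun k hk => ?_
    rw [mem_nonZeroDivisors_iff_right]
    intro a ha
    rw [mul_comm] at ha
    have hne : (t k : Module.End ℤ M) ≠ t i := fun h =>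
      (Finset.mem_Ioi.1 hk).ne' (Fin.ext (t.injective (Subtype.ext h)))
    refine Subtype.ext (LinearMap.ext fun m => hinj _ (t k).2 _ (t i).2 hne ?_)
    have := congrArg (fun b : Algebra.adjoin ℤ (insert z T) => (b : Module.End ℤ M) m) ha
    simpa using this
  have hmul : (Matrix.vandermonde v).mulVec c = 0 := by
    ext i : 1
    refine Subtype.ext ?_
    have h1 := hroot _ (t i).2
    rw [aeval_eq_sum_range, ← Fin.sum_univ_eq_sum_range
      (fun k => p.coeff k • ((t i : Module.End ℤ M) * z) ^ k)] at h1
    simp only [Matrix.mulVec, dotProduct, Matrix.vandermonde_apply, AddSubmonoidClass.coe_finsetSum]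
    rw [Pi.zero_apply, ZeroMemClass.coe_zero, ← h1]
    refine Finset.sum_congr rfl fun k _ => ?_
    rw [(show Commute (t i : Module.End ℤ M) z from hTz _ (t i).2).mul_pow]
    simpa [v, c, y] using Int.cast_commute _ _ |>.left_comm _ |>.symm
  have h0 := congrFun (Matrix.eq_zero_of_det_mem_nonZeroDivisors_of_mulVec_eq_zero hdet hmul)
    (Fin.last _)
  have h1 : z ^ p.natDegree = 0 := by
    have := congrArg Subtype.val h0
    simpa [c, y, hp.coeff_natDegree] using this
  exact not_isUnit_zero (h1 ▸ hz.pow p.natDegree)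

variable {H : Type*} [Group H]

lemma isUnit_apply_of_group (ρ : H →* Module.End ℤ M) (h : H) : IsUnit (ρ h) :=
  (Group.isUnit h).map ρ

/-- If commutators with `z` act by operators commuting with the action, only finitely many
operators arise in this way. -/
lemma finite_range_commutator_action [Module.Free ℤ M] [Module.Finite ℤ M] [Nontrivial M]
    (ρ : H →* Module.End ℤ M) (z : H) (hz : ∀ q h : H, Commute (ρ ⁅q, z⁆) (ρ h))
    (hirr : ∀ φ : Module.End ℤ M, (∀ h, Commute φ (ρ h)) → φ = 0 ∨ Function.Injective φ) :
    (Set.range fun q : H => ρ ⁅q, z⁆).Finite := by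
  refine finite_of_forall_aeval_mul_eq_zero (LinearMap.charpoly_monic (ρ z))
    (isUnit_apply_of_group ρ z) ?_ ?_ ?_ ?_
  · rintro _ ⟨q, rfl⟩ _ ⟨r, rfl⟩
    exact hz q _
  · rintro _ ⟨q, rfl⟩
    exact hz q z
  · rintro _ ⟨q, rfl⟩ _ ⟨r, rfl⟩ hne
    exact (hirr _ fun h => (hz q h).sub_left (hz r h)).resolve_left (sub_ne_zero.2 hne)
  · rintro _ ⟨q, rfl⟩
    have h1 : ρ ⁅q, z⁆ * ρ z = ρ q * ρ z * ρ q⁻¹ := by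
      rw [← map_mul, ← map_mul, ← map_mul, commutatorElement_def, inv_mul_cancel_right]
    have hpow : ∀ n, (ρ q * ρ z * ρ q⁻¹) ^ n = ρ q * ρ z ^ n * ρ q⁻¹ := fun n => by
      simp only [← map_mul, ← map_pow, conj_pow]
    have h2 : ∀ p : ℤ[X], aeval (ρ q * ρ z * ρ q⁻¹) p = ρ q * aeval (ρ z) p * ρ q⁻¹ := by
      intro p
      simp only [aeval_eq_sum_range, hpow, Finset.mul_sum, Finset.sum_mul, mul_smul_comm,
        smul_mul_assoc]
    change aeval (ρ ⁅q, z⁆ * ρ z) _ = 0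
    rw [h1, h2, LinearMap.aeval_self_charpoly, mul_zero, zero_mul]

/-- The stabilizer of `ρ z`, for `z` as in `finite_range_commutator_action`. -/
lemma exists_finiteIndex_commute [Module.Free ℤ M] [Module.Finite ℤ M] [Nontrivial M]
    (ρ : H →* Module.End ℤ M) (z : H) (hz : ∀ q h : H, Commute (ρ ⁅q, z⁆) (ρ h))
    (hirr : ∀ φ : Module.End ℤ M, (∀ h, Commute φ (ρ h)) → φ = 0 ∨ Function.Injective φ) :
    ∃ K : Subgroup H, K.FiniteIndex ∧ ρ.ker ≤ K ∧ ∀ k ∈ K, Commute (ρ k) (ρ z) := by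
  have hmul : ∀ q r : H, ρ ⁅q * r, z⁆ = ρ ⁅q, z⁆ * ρ ⁅r, z⁆ := fun q r => by
    have h1 : ⁅q * r, z⁆ = q * ⁅r, z⁆ * q⁻¹ * ⁅q, z⁆ := by
      simp only [commutatorElement_def]
      group
    rw [h1, map_mul, map_mul, map_mul, ← (hz r q).eq, mul_assoc (ρ ⁅r, z⁆), ← map_mul ρ q,
      mul_inv_cancel, map_one, mul_one, (hz r _).eq]
  let ζ : H →* Module.End ℤ M :=
    { toFun := fun q => ρ ⁅q, z⁆
      map_one' := by simp
      map_mul' := hmul }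
  refine ⟨ζ.ker, finiteIndex_ker_of_finite_range ζ (finite_range_commutator_action ρ z hz hirr),
    fun g hg => ?_, fun k hk => ?_⟩
  · have h1 : ρ g = 1 := hg
    have h2 : ρ g⁻¹ = 1 := (ρ.ker).inv_mem hg
    change ρ ⁅g, z⁆ = 1
    rw [commutatorElement_def, map_mul, map_mul, map_mul, h1, h2, one_mul, mul_one, ← map_mul,
      mul_inv_cancel, map_one]
  · have h1 : ρ ⁅k, z⁆ = 1 := hk
    have h2 : k * z = ⁅k, z⁆ * (z * k) := by simp [commutatorElement_def]
    rw [Commute, SemiconjBy, ← map_mul, ← map_mul, h2, map_mul, h1, one_mul]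

end NilpotentAction

section StronglyIrreducibleAction

open scoped commutatorElement

variable {M : Type*} [AddCommGroup M] {H : Type*} [Group H]
  {N : Type*} [Group N] [Group.IsNilpotent N] {f : H →* N} {j : Multiplicative M →* H}
  {ρ : H →* Module.End ℤ M}

lemma range_le_ker_of_conj (hj : Function.Injective j)
    (hρ : ∀ h m, j (.ofAdd (ρ h m)) = h * j (.ofAdd m) * h⁻¹) : j.range ≤ ρ.ker := by
  rintro _ ⟨m, rfl⟩
  refine LinearMap.ext fun n => Multiplicative.ofAdd.injective (hj ?_)
  rw [hρ, ← map_inv, ← map_mul, ← map_mul, mul_inv_cancel_comm]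
  rfl

lemma exists_commutator_commute (hf : f.ker ≤ ρ.ker) (K : Subgroup H)
    (h : ¬ ∀ g ∈ K, ∀ k ∈ K, Commute (ρ g) (ρ k)) :
    ∃ z ∈ K, (∃ k ∈ K, ¬ Commute (ρ z) (ρ k)) ∧
      ∀ q ∈ K, ∀ k ∈ K, Commute (ρ ⁅q, z⁆) (ρ k) := by
  classical
  have hex : ∃ n, ∀ g ∈ K.lowerCentralSeries n, ∀ k ∈ K, Commute (ρ g) (ρ k) := by
    refine ⟨Group.nilpotencyClass N, fun g hg k _ => ?_⟩
    have h1 := Subgroup.mem_map_of_mem f hg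
    rw [Subgroup.map_lowerCentralSeries] at h1
    have h2 : f g ∈ (⊤ : Subgroup N).lowerCentralSeries (Group.nilpotencyClass N) :=
      Subgroup.lowerCentralSeries_mono _ le_top h1
    rw [Subgroup.lowerCentralSeries_nilpotencyClass, Subgroup.mem_bot] at h2
    rw [show ρ g = 1 from hf h2]
    exact Commute.one_left _
  rcases hn : Nat.find hex with - | n
  · exact absurd ((Nat.find_eq_zero hex).1 hn) h
  · have h1 := Nat.find_min hex (m := n) (by omega)
    push Not at h1
    obtain ⟨z, hz, k, hk, hzk⟩ := h1
    refine ⟨z, Subgroup.lowerCentralSeries_le_self K n hz, ⟨k, hk, hzk⟩, fun q hq k hk => ?_⟩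
    refine Nat.find_spec hex _ ?_ k hk
    rw [hn, ← commutatorElement_inv]
    exact Subgroup.inv_mem _ (Subgroup.commutator_mem_commutator hz hq)

theorem uniformlyFreeSemigroup_of_strongly_irreducible [Module.Free ℤ M] [Module.Finite ℤ M]
    [Nontrivial M] (hj : Function.Injective j) (hf : f.ker ≤ j.range)
    (hρ : ∀ h m, j (.ofAdd (ρ h m)) = h * j (.ofAdd m) * h⁻¹)
    (hirr : ∀ K : Subgroup H, K.FiniteIndex → j.range ≤ K → ∀ φ : Module.End ℤ M,
      (∀ h ∈ K, Commute φ (ρ h)) → φ = 0 ∨ Function.Injective φ)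
    (hvn : ¬ Group.IsVirtuallyNilpotent H) : UniformlyFreeSemigroup H := by
  have hjρ := range_le_ker_of_conj hj hρ
  let C : Subgroup H → Submodule ℤ (Module.End ℤ M) := fun K =>
    Subalgebra.toSubmodule (Subalgebra.centralizer ℤ (ρ '' K))
  have hC : ∀ K φ, φ ∈ C K ↔ ∀ h ∈ K, Commute φ (ρ h) := fun K φ => by
    change φ ∈ Subalgebra.centralizer ℤ (ρ '' K) ↔ _
    rw [Subalgebra.mem_centralizer_iff, Set.forall_mem_image]
    exact forall₂_congr fun h _ => eq_comm
  obtain ⟨_, ⟨K, ⟨hKfin, hjK⟩, rfl⟩, hmax⟩ := wellFounded_gt.has_min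
    (C '' {K : Subgroup H | K.FiniteIndex ∧ j.range ≤ K})
    ⟨_, ⊤, ⟨inferInstance, le_top⟩, rfl⟩
  have hcomm : ∀ g ∈ K, ∀ k ∈ K, Commute (ρ g) (ρ k) := by
    by_contra hnc
    obtain ⟨z, hzK, ⟨k, hk, hzk⟩, hcom⟩ := exists_commutator_commute (hf.trans hjρ) K hnc
    obtain ⟨L, hLfin, hL, hLz⟩ := exists_finiteIndex_commute (ρ.comp K.subtype) ⟨z, hzK⟩
      (fun q h => hcom q q.2 h h.2)
      (fun φ hφ => hirr K hKfin hjK φ fun h hh => hφ ⟨h, hh⟩)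
    have hLK : L.map K.subtype ≤ K := Subgroup.map_subtype_le L
    refine hmax (C (L.map K.subtype)) ⟨_, ⟨Subgroup.finiteIndex_map_subtype hLfin, ?_⟩, rfl⟩
      (lt_of_le_of_ne (fun φ hφ => (hC _ _).2 fun h hh => (hC _ _).1 hφ h (hLK hh)) fun heq => ?_)
    · intro g hg
      exact ⟨⟨g, hjK hg⟩, hL (show ρ g = 1 from hjρ hg), rfl⟩
    · have hz : ρ z ∈ C K := by
        rw [heq, hC]
        rintro _ ⟨g, hg, rfl⟩
        exact (hLz g hg).symm
      exact hzk ((hC _ _).1 hz k hk)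
  refine UniformlyFreeSemigroup.of_finiteIndex K ?_
  let jK : Multiplicative M →* K := j.codRestrict K fun m => hjK ⟨m, rfl⟩
  refine uniformlyFreeSemigroup_of_commute_action (f := f.comp K.subtype) (j := jK)
    (ρ := ρ.comp K.subtype) (fun m n h => hj (congrArg Subtype.val h)) ?_ ?_
    (fun g h => hcomm g g.2 h h.2)
    (fun φ hφ => hirr K hKfin hjK φ fun h hh => hφ ⟨h, hh⟩) fun h => hvn h.of_finiteIndex
  · intro g hg
    obtain ⟨m, hm⟩ := hf (show (g : H) ∈ f.ker from hg)
    exact ⟨m, Subtype.ext hm⟩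
  · exact fun h m => Subtype.ext (hρ h m)

end StronglyIrreducibleAction

section NoetherianGroup

variable {G : Type*} [Group G]

lemma wellFoundedGT_subgroup_of_injective {H : Type*} [Group H] [WellFoundedGT (Subgroup H)]
    {f : G →* H} (hf : Function.Injective f) : WellFoundedGT (Subgroup G) :=
  (Monotone.strictMono_of_injective (fun _ _ => Subgroup.map_mono)
    (Subgroup.map_injective hf)).wellFoundedGT

lemma wellFoundedGT_subgroup_of_surjective {H : Type*} [Group H] [WellFoundedGT (Subgroup G)]
    {f : G →* H} (hf : Function.Surjective f) : WellFoundedGT (Subgroup H) :=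
  (Monotone.strictMono_of_injective (fun _ _ => Subgroup.comap_mono)
    (Subgroup.comap_injective hf)).wellFoundedGT

lemma wellFoundedGT_subgroup_of_isCyclic [IsCyclic G] : WellFoundedGT (Subgroup G) := by
  obtain ⟨g, hg⟩ := IsCyclic.exists_generator (α := G)
  have : WellFoundedGT (Subgroup (Multiplicative ℤ)) :=
    ((AddSubgroup.toSubgroup (A := ℤ)).symm.trans
      AddSubgroup.toIntSubmodule).strictMono.wellFoundedGT
  refine wellFoundedGT_subgroup_of_surjective (f := zpowersHom G g) fun x => ?_
  obtain ⟨k, hk⟩ := hg x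
  exact ⟨.ofAdd k, hk⟩

lemma wellFoundedGT_subgroup_of_normal (N : Subgroup G) [N.Normal] [WellFoundedGT (Subgroup N)]
    [WellFoundedGT (Subgroup (G ⧸ N))] : WellFoundedGT (Subgroup G) := by
  have : StrictMono fun K : Subgroup G => (K.subgroupOf N, K.map (QuotientGroup.mk' N)) := by
    intro K L hKL
    refine lt_of_le_of_ne ⟨Subgroup.comap_mono hKL.le, Subgroup.map_mono hKL.le⟩ fun h => ?_
    obtain ⟨h1, h2⟩ := Prod.ext_iff.1 h
    refine hKL.not_ge fun x hx => ?_
    obtain ⟨y, hy, hxy⟩ := h2.ge (Subgroup.mem_map_of_mem _ hx)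
    have h3 : y⁻¹ * x ∈ N := QuotientGroup.eq.1 hxy
    have h4 : (⟨y⁻¹ * x, h3⟩ : N) ∈ K.subgroupOf N :=
      h1.ge (L.mul_mem (L.inv_mem (hKL.le hy)) hx)
    simpa using K.mul_mem hy h4
  exact this.wellFoundedGT

lemma Subgroup.fg_of_wellFoundedGT [WellFoundedGT (Subgroup G)] (H : Subgroup G) : H.FG := by
  obtain ⟨K, ⟨hK, hKH⟩, hmax⟩ := wellFounded_gt.has_min {K : Subgroup G | K.FG ∧ K ≤ H}
    ⟨⊥, ⟨∅, by simp⟩, bot_le⟩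
  refine le_antisymm hKH (fun h hh => ?_) ▸ hK
  by_contra hn
  refine hmax (K ⊔ Subgroup.zpowers h) ⟨hK.sup ?_, sup_le hKH (by simpa using hh)⟩
    (left_lt_sup.2 fun hle => hn (hle (Subgroup.mem_zpowers h)))
  exact ⟨{h}, by simp [Subgroup.zpowers_eq_closure]⟩

end NoetherianGroup

section Polycyclic

variable {G : Type*} [Group G]

lemma wellFoundedGT_subgroup_and_isSolvable_of_cyclic_extension {H K : Subgroup G} (hle : H ≤ K)
    (hnormal : ∀ x ∈ K, ∀ h ∈ H, x * h * x⁻¹ ∈ H)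
    (hcyc : ∃ g ∈ K, ∀ x ∈ K, ∃ k : ℤ, (g ^ k)⁻¹ * x ∈ H)
    (hH : WellFoundedGT (Subgroup H) ∧ Group.IsSolvable H) :
    WellFoundedGT (Subgroup K) ∧ Group.IsSolvable K := by
  obtain ⟨hwf, hsol⟩ := hH
  obtain ⟨g, hg, hgen⟩ := hcyc
  have : (H.subgroupOf K).Normal := ⟨fun h hh x => hnormal x x.2 h hh⟩
  have e := Subgroup.subgroupOfEquivOfLe hle
  have : WellFoundedGT (Subgroup (H.subgroupOf K)) :=
    wellFoundedGT_subgroup_of_injective (f := e.toMonoidHom) e.injective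
  have : Group.IsSolvable (H.subgroupOf K) :=
    Group.isSolvable_of_isSolvable_injective (f := e.toMonoidHom) e.injective
  have : IsCyclic (K ⧸ H.subgroupOf K) := by
    refine ⟨((⟨g, hg⟩ : K) : K ⧸ H.subgroupOf K), fun x => ?_⟩
    obtain ⟨x, rfl⟩ := QuotientGroup.mk_surjective x
    obtain ⟨k, hk⟩ := hgen x x.2
    exact ⟨k, QuotientGroup.eq.2 hk⟩
  have : WellFoundedGT (Subgroup (K ⧸ H.subgroupOf K)) := wellFoundedGT_subgroup_of_isCyclic
  have : Group.IsSolvable (K ⧸ H.subgroupOf K) := Group.isSolvable_of_comm IsCyclic.commGroup.mul_comm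
  refine ⟨wellFoundedGT_subgroup_of_normal (H.subgroupOf K), ?_⟩
  exact Group.isSolvable_of_ker_le_range (H.subgroupOf K).subtype (QuotientGroup.mk' (H.subgroupOf K))
    (by simp)

lemma IsPolycyclic.wellFoundedGT_subgroup_and_isSolvable (h : IsPolycyclic G) :
    WellFoundedGT (Subgroup G) ∧ Group.IsSolvable G := by
  obtain ⟨n, P, h0, hlast, hstep⟩ := h
  have hP : ∀ i, WellFoundedGT (Subgroup (P i)) ∧ Group.IsSolvable (P i) := by
    intro i
    induction i using Fin.induction with
    | zero =>
      rw [h0]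
      exact ⟨inferInstance, inferInstance⟩
    | succ i ih =>
      exact wellFoundedGT_subgroup_and_isSolvable_of_cyclic_extension (hstep i).1 (hstep i).2.1
        (hstep i).2.2 ih
  have h1 := hP (Fin.last n)
  rw [hlast] at h1
  obtain ⟨h2, h3⟩ := h1
  have e := (Subgroup.topEquiv (G := G)).symm
  exact ⟨wellFoundedGT_subgroup_of_injective (f := e.toMonoidHom) e.injective,
    Group.isSolvable_of_isSolvable_injective (f := e.toMonoidHom) e.injective⟩

end Polycyclic

section FreeAbelianNormal

variable {G : Type*} [Group G]

lemma exists_infinite_abelian_normal [WellFoundedGT (Subgroup G)] [Group.IsSolvable G] [Infinite G] :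
    ∃ W : Subgroup G, W.Normal ∧ Infinite W ∧ ∀ x ∈ W, ∀ y ∈ W, x * y = y * x := by
  classical
  have hex : ∃ n, Finite (derivedSeries G n) := by
    obtain ⟨n, hn⟩ := Group.IsSolvable.solvable (G := G)
    exact ⟨n, by rw [hn]; infer_instance⟩
  rcases hn : Nat.find hex with - | k
  · have h1 := Nat.find_spec hex
    rw [hn, derivedSeries_zero] at h1
    exact absurd (Finite.of_equiv _ (Subgroup.topEquiv (G := G)).toEquiv)
      (not_finite_iff_infinite.2 ‹_›)
  · have h1 := Nat.find_spec hex
    rw [hn] at h1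
    have h2 : Infinite (derivedSeries G k) :=
      not_finite_iff_infinite.1 (Nat.find_min hex (m := k) (by omega))
    have : Group.FG (derivedSeries G k) :=
      (Group.fg_iff_subgroup_fg _).2 (Subgroup.fg_of_wellFoundedGT _)
    have hfin : Finite (commutatorSet (derivedSeries G k)) := by
      refine Finite.of_injective (β := derivedSeries G (k + 1)) (fun c => ⟨c, ?_⟩)
        fun c d h => Subtype.ext (Subtype.ext (Subtype.mk.inj h))
      obtain ⟨_, a, b, rfl⟩ := c
      exact Subgroup.commutator_mem_commutator a.2 b.2
    have hinf : Infinite (Subgroup.center (derivedSeries G k)) := by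
      refine not_finite_iff_infinite.1 fun h => ?_
      exact h2.not_finite ((Subgroup.finite_iff_finite_and_finiteIndex _).2
        ⟨h, inferInstance⟩)
    refine ⟨(Subgroup.center (derivedSeries G k)).map (derivedSeries G k).subtype,
      inferInstance, ?_, ?_⟩
    · exact (Subgroup.equivMapOfInjective _ _
        (Subgroup.subtype_injective _)).toEquiv.infinite_iff.1 hinf
    · rintro _ ⟨x, hx, rfl⟩ _ ⟨y, hy, rfl⟩
      exact congrArg Subtype.val (Subgroup.mem_center_iff.1 hy x)

lemma exists_injective_range_eq_range_nsmul (A : Type*) [AddCommGroup A] [AddGroup.FG A]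
    [Infinite A] : ∃ (m d : ℕ) (j : (Fin d → ℤ) →+ A), 0 < d ∧ Function.Injective j ∧
      Set.range j = Set.range fun a : A => m • a := by
  classical
  obtain ⟨d, ι, _, p, hp, k, ⟨e⟩⟩ := AddCommGroup.equiv_free_prod_directSum_zmod A
  have : ∀ i, NeZero (p i ^ k i) := fun i => ⟨pow_ne_zero _ (hp i).ne_zero⟩
  have hfin : Finite (DirectSum ι fun i => ZMod (p i ^ k i)) :=
    Finite.of_equiv _ DFinsupp.equivFunOnFintype.symm
  obtain ⟨m, hm0, hm⟩ : ∃ m : ℕ, m ≠ 0 ∧ ∀ t : DirectSum ι fun i => ZMod (p i ^ k i), m • t = 0 :=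
    ⟨Nat.card (DirectSum ι fun i => ZMod (p i ^ k i)), Nat.card_pos.ne',
      fun t => card_nsmul_eq_zero'⟩
  let c : (Fin d → ℤ) →+ A := e.symm.toAddMonoidHom.comp ((AddMonoidHom.inl _ _).comp
    (Finsupp.linearEquivFunOnFinite ℤ ℤ (Fin d)).symm.toLinearMap.toAddMonoidHom)
  have hc : Function.Injective c := fun v w h => by
    have h1 := e.symm.injective h
    exact (Finsupp.linearEquivFunOnFinite ℤ ℤ (Fin d)).symm.injective (Prod.ext_iff.1 h1).1
  refine ⟨m, d, m • c, ?_, ?_, ?_⟩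
  · rcases d with - | d
    · exact absurd (Finite.of_equiv _ e.symm.toEquiv) (not_finite_iff_infinite.2 ‹_›)
    · exact d.succ_pos
  · intro v w h
    have h1 : c (m • v) = c (m • w) := by rw [map_nsmul, map_nsmul]; exact h
    exact smul_right_injective _ hm0 (hc h1)
  · ext a
    constructor
    · rintro ⟨v, rfl⟩
      exact ⟨c v, rfl⟩
    · rintro ⟨a, rfl⟩
      refine ⟨(e a).1, e.injective ?_⟩
      change e (m • e.symm _) = e (m • a)
      rw [map_nsmul, map_nsmul, e.apply_symm_apply]
      refine Prod.ext ?_ ?_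
      · ext i
        simp
      · simp [hm]

lemma exists_free_abelian_normal [WellFoundedGT (Subgroup G)] [Group.IsSolvable G] [Infinite G] :
    ∃ (d : ℕ) (j : Multiplicative (Fin d → ℤ) →* G), 0 < d ∧ Function.Injective j ∧
      ∀ h v, h * j v * h⁻¹ ∈ j.range := by
  obtain ⟨W, hW, hinf, hcomm⟩ := exists_infinite_abelian_normal (G := G)
  let _ : CommGroup W := { mul_comm := fun x y => Subtype.ext (hcomm x x.2 y y.2) }
  have : Group.FG W := (Group.fg_iff_subgroup_fg W).2 (Subgroup.fg_of_wellFoundedGT W)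
  have : Infinite (Additive W) := hinf
  obtain ⟨m, d, j, hd, hj, hrange⟩ := exists_injective_range_eq_range_nsmul (Additive W)
  have hmem : ∀ x, x ∈ (W.subtype.comp j.toMultiplicativeLeft).range ↔ ∃ w ∈ W, w ^ m = x := by
    intro x
    constructor
    · rintro ⟨v, rfl⟩
      obtain ⟨a, ha⟩ := hrange.le ⟨v.toAdd, rfl⟩
      exact ⟨_, a.toMul.2, congrArg (fun b : Additive W => (b.toMul : G)) ha⟩
    · rintro ⟨w, hw, rfl⟩
      obtain ⟨v, hv⟩ := hrange.ge ⟨Additive.ofMul ⟨w, hw⟩, rfl⟩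
      exact ⟨.ofAdd v, congrArg (fun b : Additive W => (b.toMul : G)) hv⟩
  refine ⟨d, W.subtype.comp j.toMultiplicativeLeft, hd, W.subtype_injective.comp hj, fun h v => ?_⟩
  obtain ⟨w, hw, hwv⟩ := (hmem _).1 ⟨v, rfl⟩
  rw [hmem, ← hwv]
  exact ⟨h * w * h⁻¹, hW.conj_mem w hw h, conj_pow⟩

lemma exists_conj_action {M : Type*} [AddCommGroup M] {j : Multiplicative M →* G}
    (hj : Function.Injective j) (hnormal : ∀ h v, h * j v * h⁻¹ ∈ j.range) :
    ∃ ρ : G →* Module.End ℤ M, ∀ h m, j (.ofAdd (ρ h m)) = h * j (.ofAdd m) * h⁻¹ := by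
  choose r hr using hnormal
  have hofAdd : ∀ a b : M, j (.ofAdd a) = j (.ofAdd b) → a = b := fun a b h => hj h
  have hr' : ∀ h m, j (.ofAdd (r h (.ofAdd m)).toAdd) = h * j (.ofAdd m) * h⁻¹ :=
    fun h m => hr h (.ofAdd m)
  refine ⟨⟨⟨fun h => (AddMonoidHom.mk' (fun m => (r h (.ofAdd m)).toAdd) fun a b =>
    hofAdd _ _ ?_).toIntLinearMap, ?_⟩, fun g h => ?_⟩, hr'⟩
  · refine (hr' h (a + b)).trans ?_
    simp only [ofAdd_add, map_mul, hr', conj_mul]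
  · refine LinearMap.ext fun m => hofAdd _ _ ((hr' 1 m).trans ?_)
    simp
  · refine LinearMap.ext fun m => hofAdd _ _ ((hr' _ m).trans ?_)
    refine Eq.trans ?_ ((hr' g _).trans (congrArg (fun x => g * x * g⁻¹) (hr' h m))).symm
    group

end FreeAbelianNormal

section Dichotomy

variable {G : Type*} [Group G]

/-- `G` has a free abelian subgroup of positive rank `d` normalized by a subgroup of finite index
containing it. -/
def HasFreeAbelianNormalized (G : Type*) [Group G] (d : ℕ) : Prop :=
  0 < d ∧ ∃ (H : Subgroup G) (j : Multiplicative (Fin d → ℤ) →* G), H.FiniteIndex ∧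
    Function.Injective j ∧ j.range ≤ H ∧ ∀ h ∈ H, ∀ v, h * j v * h⁻¹ ∈ j.range

lemma HasFreeAbelianNormalized.of_finiteIndex {H : Subgroup G} [H.FiniteIndex] {d : ℕ}
    (h : HasFreeAbelianNormalized H d) : HasFreeAbelianNormalized G d := by
  obtain ⟨hd, K, j, hK, hj, hjK, hconj⟩ := h
  refine ⟨hd, K.map H.subtype, H.subtype.comp j, Subgroup.finiteIndex_map_subtype hK,
    H.subtype_injective.comp hj, ?_, ?_⟩
  · rintro _ ⟨v, rfl⟩
    exact Subgroup.mem_map_of_mem _ (hjK ⟨v, rfl⟩)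
  · rintro _ ⟨k, hk, rfl⟩ v
    obtain ⟨w, hw⟩ := hconj k hk v
    exact ⟨w, congrArg Subtype.val hw⟩

lemma hasFreeAbelianNormalized_finrank_ker {M : Type*} [AddCommGroup M] [Module.Free ℤ M]
    [Module.Finite ℤ M] {j : Multiplicative M →* G} {ρ : G →* Module.End ℤ M}
    (hj : Function.Injective j) (hρ : ∀ h m, j (.ofAdd (ρ h m)) = h * j (.ofAdd m) * h⁻¹)
    {K : Subgroup G} (hK : K.FiniteIndex) (hjK : j.range ≤ K) {φ : Module.End ℤ M}
    (hφ : ∀ h ∈ K, Commute φ (ρ h)) (hφinj : ¬ Function.Injective φ) :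
    HasFreeAbelianNormalized G (Module.finrank ℤ (LinearMap.ker φ)) := by
  let c : (Fin (Module.finrank ℤ (LinearMap.ker φ)) → ℤ) →ₗ[ℤ] M :=
    (LinearMap.ker φ).subtype ∘ₗ (Module.finBasis ℤ (LinearMap.ker φ)).equivFun.symm.toLinearMap
  have hc : Function.Injective c :=
    Subtype.val_injective.comp (Module.finBasis ℤ (LinearMap.ker φ)).equivFun.symm.injective
  have hcmem : ∀ v, φ (c v) = 0 := fun v =>
    ((Module.finBasis ℤ (LinearMap.ker φ)).equivFun.symm v).2
  refine ⟨Nat.pos_of_ne_zero fun h => hφinj (LinearMap.ker_eq_bot.1 (Submodule.finrank_eq_zero.1 h)),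
    K, j.comp (AddMonoidHom.toMultiplicative c.toAddMonoidHom), hK, hj.comp hc, ?_, ?_⟩
  · rintro _ ⟨v, rfl⟩
    exact hjK ⟨_, rfl⟩
  · intro h hh v
    have h1 : ρ h (c v.toAdd) ∈ LinearMap.ker φ := by
      have h2 := LinearMap.congr_fun (hφ h hh).eq (c v.toAdd)
      simpa [hcmem] using h2
    refine ⟨.ofAdd ((Module.finBasis ℤ (LinearMap.ker φ)).equivFun ⟨_, h1⟩), ?_⟩
    refine Eq.trans (congrArg (fun m => j (.ofAdd m)) ?_) (hρ h (c v.toAdd))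
    change c ((Module.finBasis ℤ (LinearMap.ker φ)).equivFun ⟨_, h1⟩) = _
    simp only [c, LinearMap.comp_apply, LinearEquiv.coe_coe, LinearEquiv.symm_apply_apply]
    rfl

lemma dichotomy_of_forall_quotient [WellFoundedGT (Subgroup G)] [Group.IsSolvable G]
    (ih : ∀ (H : Subgroup G) (A : Subgroup H) [A.Normal], A ≠ ⊥ →
      UniformlyFreeSemigroup (H ⧸ A) ∨ Group.IsVirtuallyNilpotent (H ⧸ A)) :
    UniformlyFreeSemigroup G ∨ Group.IsVirtuallyNilpotent G := by
  classical
  by_contra! hG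
  obtain ⟨hufs, hvn⟩ := hG
  have : Infinite G := not_finite_iff_infinite.1 fun _ => hvn ⟨⊥, inferInstance, inferInstance⟩
  have hex : ∃ d, HasFreeAbelianNormalized G d := by
    obtain ⟨d, j, hd, hj, hconj⟩ := exists_free_abelian_normal (G := G)
    exact ⟨d, hd, ⊤, j, inferInstance, hj, le_top, fun h _ => hconj h⟩
  obtain ⟨d, ⟨hd, H, j, hH, hj, hjH, hconj⟩, hmin⟩ :
      ∃ d, HasFreeAbelianNormalized G d ∧ ∀ e, HasFreeAbelianNormalized G e → d ≤ e :=
    ⟨Nat.find hex, Nat.find_spec hex, fun e he => Nat.find_min' hex he⟩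
  have : NeZero d := ⟨hd.ne'⟩
  let jH : Multiplicative (Fin d → ℤ) →* H := j.codRestrict H fun v => hjH ⟨v, rfl⟩
  have hjHinj : Function.Injective jH := fun v w h => hj (congrArg Subtype.val h)
  have hA : jH.range.Normal := ⟨by
    rintro _ ⟨v, rfl⟩ h
    obtain ⟨w, hw⟩ := hconj h h.2 v
    exact ⟨w, Subtype.ext hw⟩⟩
  have hA0 : jH.range ≠ ⊥ := fun h => by
    have : Nontrivial (Multiplicative (Fin d → ℤ)) := inferInstanceAs (Nontrivial (Fin d → ℤ))
    obtain ⟨v, hv⟩ := exists_ne (1 : Multiplicative (Fin d → ℤ))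
    refine hv (hjHinj ?_)
    rw [map_one]
    exact (Subgroup.mem_bot).1 (h ▸ ⟨v, rfl⟩)
  rcases ih H jH.range hA0 with h | ⟨N, hN, hNfin⟩
  · exact hufs (.of_finiteIndex H (h.of_surjective (QuotientGroup.mk' _)
      (QuotientGroup.mk'_surjective _)))
  let L : Subgroup H := N.comap (QuotientGroup.mk' jH.range)
  have hL : L.FiniteIndex := ⟨by
    rw [Subgroup.index_comap_of_surjective _ (QuotientGroup.mk'_surjective _)]
    exact hNfin.index_ne_zero⟩
  have hmemL : ∀ v, jH v ∈ L := fun v => by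
    change QuotientGroup.mk' jH.range (jH v) ∈ N
    rw [show QuotientGroup.mk' jH.range (jH v) = 1 from
      (QuotientGroup.eq_one_iff _).2 ⟨v, rfl⟩]
    exact N.one_mem
  let jL : Multiplicative (Fin d → ℤ) →* L := jH.codRestrict L hmemL
  have hjL : Function.Injective jL := fun v w h => hjHinj (congrArg Subtype.val h)
  have hconjL : ∀ h v, h * jL v * h⁻¹ ∈ jL.range := fun h v => by
    obtain ⟨w, hw⟩ := hA.conj_mem (jH v) ⟨v, rfl⟩ h
    exact ⟨w, Subtype.ext hw⟩
  obtain ⟨ρ, hρ⟩ := exists_conj_action hjL hconjL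
  refine hufs (.of_finiteIndex H (.of_finiteIndex L ?_))
  refine uniformlyFreeSemigroup_of_strongly_irreducible
    (f := (QuotientGroup.mk' jH.range).subgroupComap N) hjL ?_ hρ ?_
    fun h => hvn h.of_finiteIndex.of_finiteIndex
  · intro g hg
    obtain ⟨v, hv⟩ := (QuotientGroup.eq_one_iff (g : H)).1 (congrArg Subtype.val hg)
    exact ⟨v, Subtype.ext hv⟩
  · intro K hK hjK φ hφ
    refine or_iff_not_imp_right.2 fun hφinj => ?_
    have h1 := hmin _ (hasFreeAbelianNormalized_finrank_ker hjL hρ hK hjK hφ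
      hφinj).of_finiteIndex.of_finiteIndex
    have h2 := (LinearMap.ker φ).finrank_quotient_add_finrank
    rw [φ.quotKerEquivRange.finrank_eq, Module.finrank_fin_fun] at h2
    exact LinearMap.range_eq_bot.1 (Submodule.finrank_eq_zero.1 (by omega))

theorem uniformlyFreeSemigroup_or_isVirtuallyNilpotent {P : Type*} [Group P]
    [WellFoundedGT (Subgroup P)] [Group.IsSolvable P] :
    UniformlyFreeSemigroup P ∨ Group.IsVirtuallyNilpotent P := by
  suffices h : ∀ (B : Subgroup P) (K G : Type _) [Group K] [Group G] (i : K →* P) (f : K →* G),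
      Function.Injective i → Function.Surjective f → f.ker.map i = B →
      UniformlyFreeSemigroup G ∨ Group.IsVirtuallyNilpotent G from
    h _ P P (.id P) (.id P) Function.injective_id Function.surjective_id rfl
  intro B
  induction B using WellFoundedGT.induction with
  | ind B ih =>
    intro K G _ _ i f hi hf hB
    have := wellFoundedGT_subgroup_of_injective hi
    have := wellFoundedGT_subgroup_of_surjective hf
    have := Group.isSolvable_of_isSolvable_injective hi
    have := Group.isSolvable_of_surjective hf
    refine dichotomy_of_forall_quotient fun H A _ hA => ?_
    refine ih _ ?_ (H.comap f) (H ⧸ A) (i.comp (H.comap f).subtype)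
      ((QuotientGroup.mk' A).comp (f.subgroupComap H)) (hi.comp (Subgroup.subtype_injective _))
      ((QuotientGroup.mk'_surjective A).comp
        (f.subgroupComap_surjective_of_surjective H hf)) rfl
    rw [← hB]
    refine lt_of_le_not_ge ?_ fun hle => ?_
    · rintro _ ⟨x, hx, rfl⟩
      have hx1 : f x = 1 := hx
      refine ⟨⟨x, Subgroup.mem_comap.2 (hx1 ▸ H.one_mem)⟩, (QuotientGroup.eq_one_iff _).2 ?_, rfl⟩
      rw [show f.subgroupComap H ⟨x, _⟩ = 1 from Subtype.ext hx1]
      exact A.one_mem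
    · obtain ⟨a, ha⟩ := Subgroup.ne_bot_iff_exists_ne_one.1 hA
      obtain ⟨y, hy⟩ := f.subgroupComap_surjective_of_surjective H hf a
      have h1 : i y ∈ f.ker.map i :=
        hle ⟨y, (QuotientGroup.eq_one_iff _).2 (hy ▸ a.2), rfl⟩
      have h2 : f y = 1 := (Subgroup.mem_map_iff_mem hi).1 h1
      exact ha (Subtype.ext (Subtype.ext ((congrArg Subtype.val hy).symm.trans h2)))

end Dichotomy

/-- Every finitely generated virtually polycyclic group of exponential growth has
uniformly exponential growth, i.e. `ω(G) > 1`. -/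
theorem virtually_polycyclic_exponential_growth_uniform
    {G : Type*} [Group G] (hfg : Group.FG G) (hvp : IsVirtuallyPolycyclic G)
    (hexp : HasExponentialGrowth G) :
    1 < minGrowthRate G := by
  obtain ⟨P, hP, hpoly⟩ := hvp
  obtain ⟨_, _⟩ := hpoly.wellFoundedGT_subgroup_and_isSolvable
  rcases uniformlyFreeSemigroup_or_isVirtuallyNilpotent (P := P) with h | h
  · exact (h.of_finiteIndex P).one_lt_minGrowthRate hfg
  · obtain ⟨N, hN, hNfin⟩ : Group.IsVirtuallyNilpotent G := h.of_finiteIndex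
    exact absurd hexp
      (SubexponentialGrowth.of_isNilpotent.of_finiteIndex N).not_hasExponentialGrowth
end

section
/- Let G be a group with a finite generating set X and let R be a finitely generated subgroup of G. Then ω(G, X) ≥ ω(R)^{1/depth_X(R)}. -/
section WordLength

variable {G : Type*} [Group G]

/-- The word length `‖g‖_X`: the least `n` such that `g` is a product of `n` letters
from `X ∪ X⁻¹`. -/
noncomputable def wordLength (X : Finset G) (g : G) : ℕ :=
  sInf {n : ℕ | g ∈ wordBall X n}

/-- `depth_X(Y) = max_{y ∈ Y} ‖y‖_X` for a finite subset `Y ⊆ G`. -/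
noncomputable def depthFinset (X Y : Finset G) : ℕ :=
  Y.sup (wordLength X)

/-- `depth_X(H) = min {depth_X(Y) : Y finite, ⟨Y⟩ = H}` for a finitely generated
subgroup `H ≤ G`. -/
noncomputable def depthSubgroup (X : Finset G) (H : Subgroup G) : ℕ :=
  sInf {d : ℕ | ∃ Y : Finset G, Subgroup.closure (Y : Set G) = H ∧ d = depthFinset X Y}

end WordLength

namespace GrowthRate

open scoped Pointwise

variable {G : Type*} [Group G]

lemma one_mem_wordBall (X : Finset G) (n : ℕ) : (1 : G) ∈ wordBall X n :=
  ⟨[], by simp⟩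

lemma wordBall_mono (X : Finset G) {m n : ℕ} (h : m ≤ n) : wordBall X m ⊆ wordBall X n :=
  fun _ ⟨l, hl, hx, hg⟩ => ⟨l, hl.trans h, hx, hg⟩

lemma inv_mem_wordBall {X : Finset G} {n : ℕ} {g : G} (h : g ∈ wordBall X n) :
    g⁻¹ ∈ wordBall X n := by
  obtain ⟨l, hl, hx, rfl⟩ := h
  refine ⟨(l.map (·⁻¹)).reverse, by simpa using hl, fun x hxl => ?_,
    (List.prod_inv_reverse l).symm⟩
  obtain ⟨y, hy, rfl⟩ : ∃ y ∈ l, y⁻¹ = x := by simpa using hxl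
  simpa [or_comm] using hx y hy

lemma wordBall_add (X : Finset G) (m n : ℕ) :
    wordBall X (m + n) = wordBall X m * wordBall X n := by
  ext g
  constructor
  · rintro ⟨l, hl, hx, rfl⟩
    refine Set.mem_mul.2 ⟨(l.take m).prod, ⟨l.take m, by simp, fun x h => ?_, rfl⟩,
      (l.drop m).prod, ⟨l.drop m, by simp; omega, fun x h => ?_, rfl⟩,
      List.prod_take_mul_prod_drop l m⟩
    · exact hx x (List.mem_of_mem_take h)
    · exact hx x (List.mem_of_mem_drop h)
  · rintro ⟨_, ⟨k, hk, hxk, rfl⟩, _, ⟨l, hl, hxl, rfl⟩, rfl⟩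
    refine ⟨k ++ l, by simp; omega, fun x h => ?_, by simp⟩
    exact (List.mem_append.1 h).elim (hxk x) (hxl x)

lemma finite_wordBall (X : Finset G) (n : ℕ) : (wordBall X n).Finite := by
  induction n with
  | zero =>
    refine (Set.finite_singleton (1 : G)).subset ?_
    rintro _ ⟨l, hl, -, rfl⟩
    simp [List.eq_nil_of_length_eq_zero (Nat.le_zero.1 hl)]
  | succ n ih =>
    rw [wordBall_add]
    refine ih.mul (((X.finite_toSet.union X.finite_toSet.inv).insert 1).subset ?_)
    rintro _ ⟨l, hl, hx, rfl⟩
    match l, hl with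
    | [], _ => simp
    | [x], _ => simpa using Or.inr (hx x (by simp))

lemma one_le_growthFn (X : Finset G) (n : ℕ) : 1 ≤ growthFn X n := by
  have := (finite_wordBall X n).to_subtype
  have : Nonempty (wordBall X n) := ⟨⟨1, one_mem_wordBall X n⟩⟩
  exact Nat.card_pos

lemma growthFn_add_le (X : Finset G) (m n : ℕ) :
    growthFn X (m + n) ≤ growthFn X m * growthFn X n := by
  unfold growthFn
  rw [wordBall_add]
  exact Set.natCard_mul_le

lemma growthFn_mul_le (X : Finset G) (d n : ℕ) :
    growthFn X (d * n) ≤ growthFn X n ^ d := by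
  induction d with
  | zero =>
    have : wordBall X 0 ⊆ {1} := by
      rintro _ ⟨l, hl, -, rfl⟩
      simp [List.eq_nil_of_length_eq_zero (Nat.le_zero.1 hl)]
    simpa [growthFn] using Nat.card_mono (Set.finite_singleton (1 : G)) this
  | succ d ih =>
    rw [Nat.succ_mul, pow_succ]
    exact (growthFn_add_le X _ _).trans (Nat.mul_le_mul_right _ ih)

lemma exists_mem_wordBall {X : Finset G} (hX : Subgroup.closure (X : Set G) = ⊤) (g : G) :
    ∃ n, g ∈ wordBall X n := by
  have hg : g ∈ Subgroup.closure (X : Set G) := hX ▸ Subgroup.mem_top g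
  rw [← Subgroup.mem_toSubmonoid, Subgroup.closure_toSubmonoid] at hg
  obtain ⟨l, hl, rfl⟩ := Submonoid.exists_list_of_mem_closure hg
  exact ⟨l.length, l, le_rfl, hl, rfl⟩

lemma mem_wordBall_wordLength {X : Finset G} (hX : Subgroup.closure (X : Set G) = ⊤) (g : G) :
    g ∈ wordBall X (wordLength X g) :=
  Nat.sInf_mem (exists_mem_wordBall hX g)

/-- If a homomorphism sends each letter of `Y` into the ball of radius `d`, then it sends the
ball of radius `n` into the ball of radius `d * n`. -/
lemma map_mem_wordBall_mul {H : Type*} [Group H] {X : Finset G} {Y : Finset H} (f : H →* G)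
    {d n : ℕ} (hY : ∀ y ∈ Y, f y ∈ wordBall X d) {h : H} (hh : h ∈ wordBall Y n) :
    f h ∈ wordBall X (d * n) := by
  obtain ⟨l, hl, hx, rfl⟩ := hh
  refine wordBall_mono X (Nat.mul_le_mul_left d hl) ?_
  clear hl
  induction l with
  | nil => simpa using one_mem_wordBall X _
  | cons x l ih =>
    rw [List.prod_cons, map_mul, List.length_cons, Nat.mul_succ, add_comm, wordBall_add]
    refine Set.mul_mem_mul ?_ (ih fun y hy => hx y (List.mem_cons_of_mem _ hy))
    rcases hx x List.mem_cons_self with h | h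
    · exact hY x h
    · simpa using inv_mem_wordBall (hY _ h)

lemma growthFn_le_of_injective {H : Type*} [Group H] {X : Finset G} {Y : Finset H} (f : H →* G)
    (hf : Function.Injective f) {d : ℕ} (hY : ∀ y ∈ Y, f y ∈ wordBall X d) (n : ℕ) :
    growthFn Y n ≤ growthFn X (d * n) := by
  have := (finite_wordBall X (d * n)).to_subtype
  exact Nat.card_le_card_of_injective
    (fun h : wordBall Y n => (⟨f h, map_mem_wordBall_mul f hY h.2⟩ : wordBall X (d * n)))
    fun a b hab => Subtype.ext (hf (congrArg Subtype.val hab))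

lemma growthRateX_nonneg (X : Finset G) : 0 ≤ growthRateX X :=
  Real.iInf_nonneg fun _ => by positivity

lemma one_le_growthRateX (X : Finset G) : 1 ≤ growthRateX X :=
  le_ciInf fun n => Real.one_le_rpow (by exact_mod_cast one_le_growthFn X (n + 1))
    (by positivity)

lemma growthRateX_le (X : Finset G) (n : ℕ) :
    growthRateX X ≤ (growthFn X (n + 1) : ℝ) ^ ((1 : ℝ) / (n + 1)) :=
  ciInf_le ⟨0, by rintro _ ⟨k, rfl⟩; positivity⟩ n

lemma minGrowthRate_nonneg : 0 ≤ minGrowthRate G :=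
  Real.sInf_nonneg (by rintro _ ⟨X, -, rfl⟩; exact growthRateX_nonneg X)

lemma minGrowthRate_le {X : Finset G} (hX : Subgroup.closure (X : Set G) = ⊤) :
    minGrowthRate G ≤ growthRateX X :=
  csInf_le ⟨0, by rintro _ ⟨Y, -, rfl⟩; exact growthRateX_nonneg Y⟩ ⟨X, hX, rfl⟩

lemma growthRateX_rpow_le_of_injective {H : Type*} [Group H] {X : Finset G} {Y : Finset H}
    (f : H →* G) (hf : Function.Injective f) {d : ℕ} (hd : d ≠ 0)
    (hY : ∀ y ∈ Y, f y ∈ wordBall X d) :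
    growthRateX Y ^ ((1 : ℝ) / d) ≤ growthRateX X := by
  refine le_ciInf fun n => ?_
  have hcard : (growthFn Y (n + 1) : ℝ) ≤ (growthFn X (n + 1) : ℝ) ^ d := by
    exact_mod_cast (growthFn_le_of_injective f hf hY (n + 1)).trans (growthFn_mul_le X d (n + 1))
  calc growthRateX Y ^ ((1 : ℝ) / d)
      ≤ (((growthFn X (n + 1) : ℝ) ^ d) ^ ((1 : ℝ) / (n + 1))) ^ ((1 : ℝ) / d) := by
        refine Real.rpow_le_rpow (growthRateX_nonneg Y) ((growthRateX_le Y n).trans ?_)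
          (by positivity)
        exact Real.rpow_le_rpow (by positivity) hcard (by positivity)
    _ = (growthFn X (n + 1) : ℝ) ^ ((1 : ℝ) / (n + 1)) := by
        rw [← Real.rpow_mul (by positivity), mul_comm, Real.rpow_mul (by positivity), one_div,
          Real.pow_rpow_inv_natCast (by positivity) hd]

end GrowthRate

open GrowthRate

/-- **Lemma 6.1 (Osin).** If `G` is a group with finite generating set `X` and `R` is a
finitely generated subgroup of `G`, then `ω(G,X) ≥ ω(R)^{1/depth_X(R)}`. -/
theorem growthRateX_ge_rpow_depth
    {G : Type*} [Group G] (X : Finset G) (hX : Subgroup.closure (X : Set G) = ⊤)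
    (R : Subgroup G) (hR : R.FG) :
    minGrowthRate R ^ ((1 : ℝ) / (depthSubgroup X R : ℝ)) ≤ growthRateX X := by
  rcases eq_or_ne (depthSubgroup X R) 0 with h0 | h0
  · simpa [h0] using one_le_growthRateX X
  have hne : {d : ℕ | ∃ Y : Finset G, Subgroup.closure (Y : Set G) = R ∧
      d = depthFinset X Y}.Nonempty := by
    obtain ⟨Y, hY⟩ := hR
    exact ⟨_, Y, hY, rfl⟩
  obtain ⟨Y, hYR, hYd⟩ : ∃ Y : Finset G, Subgroup.closure (Y : Set G) = R ∧
      depthSubgroup X R = depthFinset X Y := Nat.sInf_mem hne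
  let Z : Finset R := Y.preimage R.subtype R.subtype_injective.injOn
  have hZ : Subgroup.closure (Z : Set R) = ⊤ := by
    subst hYR
    simp only [Z, Finset.coe_preimage]
    exact Subgroup.closure_closure_coe_preimage
  have hball : ∀ z ∈ Z, R.subtype z ∈ wordBall X (depthSubgroup X R) := fun z hz =>
    wordBall_mono X (hYd ▸ Finset.le_sup (f := wordLength X) (Finset.mem_preimage.1 hz))
      (mem_wordBall_wordLength hX _)
  exact (Real.rpow_le_rpow minGrowthRate_nonneg (minGrowthRate_le hZ) (by positivity)).trans
    (growthRateX_rpow_le_of_injective R.subtype R.subtype_injective h0 hball)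
end

section
/- Let H be a group generated by two elements v and w, and suppose the subgroup H_{v,w} = ⟨v^{−l} w v^{l} : l ∈ ℤ⟩ is not finitely generated. Then for distinct finite binary sequences α = (α_1, …, α_p) and β = (β_1, …, β_q) with entries in {0,1}, the elements t(α) = w^{α_1} v w^{α_2} v ⋯ w^{α_p} v and t(β) = w^{β_1} v w^{β_2} v ⋯ w^{β_q} v are distinct; consequently γ_H^{{v,w}}(2p) ≥ 2^p for all p, and ω(H, {v,w}) ≥ √2. -/
section WordBall

variable {G : Type*} [Group G]

theorem finite_wordBall (X : Finset G) (n : ℕ) : (wordBall X n).Finite := by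
  have hX : {x : G | x ∈ X ∨ x⁻¹ ∈ X}.Finite :=
    X.finite_toSet.union (X.finite_toSet.preimage inv_injective.injOn)
  have := hX.to_subtype
  refine ((List.finite_length_le {x : G | x ∈ X ∨ x⁻¹ ∈ X} n).image
    fun l => (l.map Subtype.val).prod).subset ?_
  rintro g ⟨l, hl, hlX, rfl⟩
  lift l to List {x : G | x ∈ X ∨ x⁻¹ ∈ X} using hlX
  exact ⟨l, by simpa using hl, rfl⟩

open scoped Pointwise in
theorem wordBall_add_subset (X : Finset G) (m n : ℕ) :
    wordBall X (m + n) ⊆ wordBall X m * wordBall X n := by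
  rintro g ⟨l, hl, hlX, rfl⟩
  refine Set.mem_mul.2 ⟨(l.take m).prod, ⟨l.take m, ?_, ?_, rfl⟩,
    (l.drop m).prod, ⟨l.drop m, ?_, ?_, rfl⟩, ?_⟩
  · simp
  · exact fun x hx => hlX x (List.mem_of_mem_take hx)
  · simp only [List.length_drop]
    omega
  · exact fun x hx => hlX x (List.mem_of_mem_drop hx)
  · rw [← List.prod_append, List.take_append_drop]

open scoped Pointwise in
theorem growthFn_add_le (X : Finset G) (m n : ℕ) :
    growthFn X (m + n) ≤ growthFn X m * growthFn X n :=
  (Nat.card_mono ((finite_wordBall X m).mul (finite_wordBall X n))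
    (wordBall_add_subset X m n)).trans Set.natCard_mul_le

/-- By submultiplicativity, exponential lower bounds along even radii bound the growth rate. -/
theorem sqrt_two_le_growthRateX {X : Finset G}
    (h : ∀ p : ℕ, 2 ^ p ≤ growthFn X (2 * p)) : Real.sqrt 2 ≤ growthRateX X := by
  refine le_ciInf fun n => ?_
  have h₁ : (2 : ℝ) ^ (n + 1) ≤ (growthFn X (n + 1) : ℝ) ^ 2 := by
    have := (h (n + 1)).trans ((two_mul (n + 1)).symm ▸ growthFn_add_le X (n + 1) (n + 1))
    rw [← sq] at this
    exact_mod_cast this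
  have h₂ : Real.sqrt 2 ^ (n + 1) ≤ growthFn X (n + 1) := by
    refine le_of_sq_le_sq ?_ (Nat.cast_nonneg _)
    rwa [← pow_mul, mul_comm, pow_mul, Real.sq_sqrt zero_le_two]
  calc Real.sqrt 2 = (Real.sqrt 2 ^ (n + 1)) ^ ((1 : ℝ) / (n + 1)) := by
        rw [one_div]
        exact_mod_cast (Real.pow_rpow_inv_natCast (Real.sqrt_nonneg 2) n.succ_ne_zero).symm
    _ ≤ _ := Real.rpow_le_rpow (by positivity) h₂ (by positivity)

end WordBall

section BinaryProducts

variable {H : Type*} [Group H] (v w : H)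

/-- The element `w ^ α₁ * v * ⋯ * w ^ αₚ * v` attached to a binary sequence `α`. -/
def binaryProd (α : List Bool) : H :=
  (α.map fun b => (if b then w else 1) * v).prod

/-- The subgroup generated by the conjugates `v ^ i * w * v ^ (-i)` with `0 ≤ i < n`. -/
def conjSpan (n : ℕ) : Subgroup H :=
  Subgroup.closure ((fun i : ℕ => v ^ i * w * (v ^ i)⁻¹) '' Set.Iio n)

variable {v w}

theorem conj_mem_conjSpan {i n : ℕ} (h : i < n) : v ^ i * w * (v ^ i)⁻¹ ∈ conjSpan v w n :=
  Subgroup.subset_closure ⟨i, h, rfl⟩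

theorem conjSpan_mono {m n : ℕ} (h : m ≤ n) : conjSpan v w m ≤ conjSpan v w n :=
  Subgroup.closure_mono (Set.image_mono (Set.Iio_subset_Iio h))

theorem conjSpan_fg (n : ℕ) : (conjSpan v w n).FG :=
  (Subgroup.fg_iff _).2 ⟨_, rfl, (Set.finite_Iio n).image _⟩

/-- Conjugation by `u` preserves `conjSpan v w n` once it maps the generators into it. -/
theorem conj_mem_of_forall_generator {u : H} {n : ℕ} {K : Subgroup H}
    (h : ∀ i < n, u * (v ^ i * w * (v ^ i)⁻¹) * u⁻¹ ∈ K)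
    {g : H} (hg : g ∈ conjSpan v w n) : u * g * u⁻¹ ∈ K := by
  have : conjSpan v w n ≤ K.comap (MulAut.conj u).toMonoidHom := by
    rw [conjSpan, Subgroup.closure_le]
    rintro _ ⟨i, hi, rfl⟩
    exact h i hi
  exact this hg

theorem conj_mem_conjSpan_succ {n : ℕ} {g : H} (hg : g ∈ conjSpan v w n) :
    v * g * v⁻¹ ∈ conjSpan v w (n + 1) := by
  refine conj_mem_of_forall_generator (fun i hi => ?_) hg
  convert conj_mem_conjSpan (v := v) (w := w) (Nat.succ_lt_succ hi) using 1
  simp only [pow_succ']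
  group

theorem conjSpan_succ_le {k : ℕ} (h : v ^ k * w * (v ^ k)⁻¹ ∈ conjSpan v w k) :
    conjSpan v w (k + 1) ≤ conjSpan v w k := by
  rw [conjSpan, Subgroup.closure_le]
  rintro _ ⟨i, hi, rfl⟩
  rcases (Nat.lt_succ_iff.1 hi).lt_or_eq with hi | rfl
  · exact conj_mem_conjSpan hi
  · exact h

theorem conj_mem_conjSpan_of_le {k n : ℕ} (h : v ^ k * w * (v ^ k)⁻¹ ∈ conjSpan v w k)
    (hkn : k ≤ n) : v ^ n * w * (v ^ n)⁻¹ ∈ conjSpan v w n := by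
  induction n, hkn using Nat.le_induction with
  | base => exact h
  | succ n _ ih =>
    convert conj_mem_conjSpan_succ ih using 1
    simp only [pow_succ']
    group

/-- If both one-sided extensions of the list of conjugates become redundant, then the subgroup
generated by all conjugates is finitely generated. -/
theorem closure_conj_fg {k m : ℕ} (hk : v ^ k * w * (v ^ k)⁻¹ ∈ conjSpan v w k)
    (hm : v⁻¹ * w * v ∈ conjSpan v w m) :
    (Subgroup.closure {x : H | ∃ l : ℤ, x = (v ^ l)⁻¹ * w * v ^ l}).FG := by
  set n := max (max k m) 1
  have hn : v ^ n * w * (v ^ n)⁻¹ ∈ conjSpan v w n := conj_mem_conjSpan_of_le hk (by omega)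
  have hinv : v⁻¹ * w * v ∈ conjSpan v w n := conjSpan_mono (by omega) hm
  have hw : w ∈ conjSpan v w n := by
    simpa using conj_mem_conjSpan (v := v) (w := w) (show 0 < n by omega)
  have hpos : ∀ g ∈ conjSpan v w n, v * g * v⁻¹ ∈ conjSpan v w n := fun g hg =>
    conjSpan_succ_le hn (conj_mem_conjSpan_succ hg)
  have hneg : ∀ g ∈ conjSpan v w n, v⁻¹ * g * v ∈ conjSpan v w n := fun g hg => by
    have := conj_mem_of_forall_generator (u := v⁻¹) (K := conjSpan v w n) (fun i hi => ?_) hg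
    · simpa using this
    · cases i with
      | zero => simpa using hinv
      | succ i =>
        convert conj_mem_conjSpan (v := v) (w := w) (show i < n by omega) using 1
        simp only [pow_succ']
        group
  suffices Subgroup.closure {x : H | ∃ l : ℤ, x = (v ^ l)⁻¹ * w * v ^ l} = conjSpan v w n by
    rw [this]
    exact conjSpan_fg n
  apply le_antisymm
  · rw [Subgroup.closure_le]
    rintro _ ⟨l, rfl⟩
    simp only [SetLike.mem_coe]
    induction l using Int.induction_on with
    | zero => simpa using hw
    | succ i ih =>
      convert hneg _ ih using 1
      simp only [zpow_add_one]
      group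
    | pred i ih =>
      convert hpos _ ih using 1
      simp only [zpow_sub_one]
      group
  · rw [conjSpan, Subgroup.closure_le]
    rintro _ ⟨i, -, rfl⟩
    exact Subgroup.subset_closure ⟨-i, by simp⟩

@[simp]
theorem binaryProd_nil : binaryProd v w [] = 1 := rfl

@[simp]
theorem binaryProd_cons (a : Bool) (α : List Bool) :
    binaryProd v w (a :: α) = (if a then w else 1) * v * binaryProd v w α := by
  simp [binaryProd]

@[simp]
theorem binaryProd_append (α β : List Bool) :
    binaryProd v w (α ++ β) = binaryProd v w α * binaryProd v w β := by
  simp [binaryProd]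

theorem binaryProd_mul_inv_mem (α : List Bool) :
    binaryProd v w α * (v ^ α.length)⁻¹ ∈ conjSpan v w α.length := by
  induction α with
  | nil => simp
  | cons a α ih =>
    have hw : (if a then w else 1) ∈ conjSpan v w (α.length + 1) := by
      split_ifs
      · simpa using conj_mem_conjSpan (v := v) (w := w) α.length.succ_pos
      · exact one_mem _
    rw [List.length_cons]
    convert mul_mem hw (conj_mem_conjSpan_succ ih) using 1
    simp only [binaryProd_cons, pow_succ', mul_inv_rev]
    simp only [mul_assoc]

/-- Two distinct sequences of the same length with equal products make the next conjugate
redundant. -/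
theorem exists_conj_mem_conjSpan {α β : List Bool} (hlen : α.length = β.length) (hne : α ≠ β)
    (h : binaryProd v w α = binaryProd v w β) :
    ∃ k, v ^ k * w * (v ^ k)⁻¹ ∈ conjSpan v w k := by
  induction α using List.reverseRecOn generalizing β with
  | nil => exact absurd (List.length_eq_zero_iff.1 hlen.symm).symm hne
  | append_singleton α a ih =>
    rcases List.eq_nil_or_concat' β with rfl | ⟨β, b, rfl⟩
    · simp at hlen
    have hlen' : α.length = β.length := by simpa using hlen
    have hα := binaryProd_mul_inv_mem (v := v) (w := w) α
    have hβ := binaryProd_mul_inv_mem (v := v) (w := w) β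
    rw [← hlen'] at hβ
    simp only [binaryProd_append, binaryProd_cons, binaryProd_nil, mul_one, ← mul_assoc,
      mul_left_inj] at h
    cases a <;> cases b <;>
      simp only [reduceIte, Bool.false_eq_true, mul_one, mul_left_inj] at h
    · exact ih hlen' (fun e => hne (by rw [e])) h
    · refine ⟨α.length, ?_⟩
      convert mul_mem (inv_mem hβ) hα using 1
      rw [h]
      group
    · refine ⟨α.length, ?_⟩
      convert mul_mem (inv_mem hα) hβ using 1
      rw [← h]
      group
    · exact ih hlen' (fun e => hne (by rw [e])) h

/-- Two distinct sequences of the same length with equal products make the previous conjugate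
redundant. -/
theorem exists_inv_conj_mem_conjSpan {α β : List Bool} (hlen : α.length = β.length) (hne : α ≠ β)
    (h : binaryProd v w α = binaryProd v w β) :
    ∃ m, v⁻¹ * w * v ∈ conjSpan v w m := by
  induction α generalizing β with
  | nil => exact absurd (List.length_eq_zero_iff.1 hlen.symm).symm hne
  | cons a α ih =>
    rcases β with _ | ⟨b, β⟩
    · simp at hlen
    have hlen' : α.length = β.length := by simpa using hlen
    have hα := binaryProd_mul_inv_mem (v := v) (w := w) α
    have hβ := binaryProd_mul_inv_mem (v := v) (w := w) β
    rw [← hlen'] at hβ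
    simp only [binaryProd_cons] at h
    cases a <;> cases b <;>
      simp only [reduceIte, Bool.false_eq_true, one_mul, mul_right_inj] at h
    · exact ih hlen' (fun e => hne (by rw [e])) h
    · refine ⟨α.length, ?_⟩
      convert mul_mem hα (inv_mem hβ) using 1
      rw [eq_inv_mul_of_mul_eq h]
      group
    · refine ⟨α.length, ?_⟩
      convert mul_mem hβ (inv_mem hα) using 1
      rw [eq_inv_mul_of_mul_eq h.symm]
      group
    · exact ih hlen' (fun e => hne (by rw [e])) h

theorem append_cons_ne_of_length_lt {α β : List Bool} (h : α.length < β.length) :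
    α ++ (!β[α.length]) :: β ≠ β ++ (!β[α.length]) :: α := by
  intro e
  have := congrArg (fun l => l[α.length]?) e
  simp [List.getElem?_append_left h, List.getElem?_eq_getElem h] at this

theorem binaryProd_injective
    (hnfg : ¬ (Subgroup.closure {x : H | ∃ l : ℤ, x = (v ^ l)⁻¹ * w * v ^ l}).FG) :
    Function.Injective (binaryProd v w) := by
  have key : ∀ α β : List Bool, α.length = β.length →
      binaryProd v w α = binaryProd v w β → α = β := fun α β hlen h => by
    by_contra hne
    obtain ⟨k, hk⟩ := exists_conj_mem_conjSpan hlen hne h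
    obtain ⟨m, hm⟩ := exists_inv_conj_mem_conjSpan hlen hne h
    exact hnfg (closure_conj_fg hk hm)
  have hlt : ∀ α β : List Bool, α.length < β.length →
      binaryProd v w α ≠ binaryProd v w β := fun α β hlen h =>
    append_cons_ne_of_length_lt hlen
      (key _ _ (by simp only [List.length_append, List.length_cons]; omega) (by simp [h]))
  intro α β h
  rcases lt_trichotomy α.length β.length with hl | hl | hl
  · exact absurd h (hlt _ _ hl)
  · exact key _ _ hl h
  · exact absurd h.symm (hlt _ _ hl)

theorem binaryProd_mem_wordBall [DecidableEq H] (α : List Bool) :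
    binaryProd v w α ∈ wordBall ({v, w} : Finset H) (2 * α.length) := by
  induction α with
  | nil => exact ⟨[], by simp⟩
  | cons a α ih =>
    obtain ⟨l, hl, hlX, hprod⟩ := ih
    cases a
    · refine ⟨v :: l, ?_, ?_, by simp [hprod]⟩
      · simp only [List.length_cons]
        omega
      · exact List.forall_mem_cons.2 ⟨by simp, hlX⟩
    · refine ⟨w :: v :: l, ?_, ?_, by simp [hprod, mul_assoc]⟩
      · simp only [List.length_cons]
        omega
      · exact List.forall_mem_cons.2 ⟨by simp, List.forall_mem_cons.2 ⟨by simp, hlX⟩⟩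

theorem two_pow_le_growthFn [DecidableEq H] (h : Function.Injective (binaryProd v w)) (p : ℕ) :
    2 ^ p ≤ growthFn ({v, w} : Finset H) (2 * p) := by
  have := (finite_wordBall ({v, w} : Finset H) (2 * p)).to_subtype
  let f : (Fin p → Bool) → wordBall ({v, w} : Finset H) (2 * p) := fun a =>
    ⟨binaryProd v w (List.ofFn a), by
      simpa using binaryProd_mem_wordBall (v := v) (w := w) (List.ofFn a)⟩
  have hf : Function.Injective f := fun a b hab =>
    List.ofFn_injective (h (congrArg Subtype.val hab))
  simpa [growthFn] using Nat.card_le_card_of_injective f hf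

end BinaryProducts

/-- Distinct binary sequences `α` give distinct elements
`t(α) = w^{α_1} v w^{α_2} v ⋯ w^{α_p} v` when `H_{v,w} = ⟨v⁻ˡ w vˡ : l ∈ ℤ⟩` is not
finitely generated; consequently `γ_H^{{v,w}}(2p) ≥ 2^p` and `ω(H, {v,w}) ≥ √2`. -/
theorem growth_of_two_generated_with_infinitely_generated_conjugation_subgroup
    {H : Type*} [Group H] [DecidableEq H] (v w : H)
    (hgen : Subgroup.closure ({v, w} : Set H) = ⊤)
    (hnfg : ¬ (Subgroup.closure {x : H | ∃ l : ℤ, x = (v ^ l)⁻¹ * w * v ^ l}).FG) :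
    (∀ α β : List Bool, α ≠ [] → β ≠ [] → α ≠ β →
      (α.map fun b => (if b then w else 1) * v).prod ≠
        (β.map fun b => (if b then w else 1) * v).prod) ∧
    (∀ p : ℕ, 2 ^ p ≤ growthFn ({v, w} : Finset H) (2 * p)) ∧
    Real.sqrt 2 ≤ growthRateX ({v, w} : Finset H) := by
  have hinj := binaryProd_injective hnfg
  have hgrowth := two_pow_le_growthFn hinj
  exact ⟨fun α β _ _ hne h => hne (hinj h), hgrowth, sqrt_two_le_growthRateX hgrowth⟩
end

section
/- Let G be a group generated by a finite set X and let (G_i)_{i∈ℕ} be groups each generated by (a copy of) the same set X. Suppose that for every m ∈ ℕ there exists N ∈ ℕ such that for all i > N the balls of radius m centered at the identity in the Cayley graphs of G_i and G coincide (in particular γ_{G_i}^X(m) = γ_G^X(m)). Then limsup_{i→∞} ω(G_i, X) ≤ ω(G, X). -/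
section MarkedGrowth

variable {S : Type*} {G : Type*} [Group G]

/-- The ball of radius `n` in a group `G` marked by a map `x : S → G` (a copy of the
generating set `X = x(S)`): products of at most `n` letters `x(s)^{±1}`. -/
def markedBall (x : S → G) (n : ℕ) : Set G :=
  {g | ∃ l : List G, l.length ≤ n ∧ (∀ a ∈ l, ∃ s : S, a = x s ∨ a = (x s)⁻¹) ∧
    l.prod = g}

/-- The growth function `γ_G^X(n)` of `G` with respect to the marking `x : S → G`. -/
noncomputable def markedGrowthFn (x : S → G) (n : ℕ) : ℕ :=
  Nat.card (markedBall x n)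

/-- The exponential growth rate `ω(G,X) = lim_n γ_G^X(n)^{1/n} = inf_{n≥1} γ_G^X(n)^{1/n}`
of `G` with respect to the marking `x : S → G`. -/
noncomputable def markedGrowthRate (x : S → G) : ℝ :=
  ⨅ n : ℕ, (markedGrowthFn x (n + 1) : ℝ) ^ ((1 : ℝ) / (n + 1))

end MarkedGrowth

/-- **Lemma 7.1 (Osin).** Suppose the groups `G_i`, all generated by a copy of the same
finite set `X` (markings `xi i : S → G i`), converge to the group `G` (marked by
`x : S → G`) in the Grigorchuk topology of local isomorphism: for every radius `m` the
balls of radius `m` in `G_i` and `G` eventually coincide, so that in particular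
`γ_{G_i}^X(m) = γ_G^X(m)` for all large `i`. Then `limsup_i ω(G_i, X) ≤ ω(G, X)`. -/
theorem limsup_growthRate_le_of_local_convergence
    {S : Type*} [Finite S] {G : Type*} [Group G] (x : S → G)
    (hx : Subgroup.closure (Set.range x) = ⊤)
    (Gi : ℕ → Type*) [∀ i, Group (Gi i)] (xi : ∀ i, S → Gi i)
    (hxi : ∀ i, Subgroup.closure (Set.range (xi i)) = ⊤)
    (happrox : ∀ m : ℕ, ∃ N : ℕ, ∀ i > N, markedGrowthFn (xi i) m = markedGrowthFn x m) :
    Filter.limsup (fun i => markedGrowthRate (xi i)) Filter.atTop ≤ markedGrowthRate x := by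
  refine le_ciInf fun n => Filter.limsup_le_of_le ?_ ?_
  · refine Filter.IsCoboundedUnder.of_frequently_ge (a := 0) (Filter.Frequently.of_forall ?_)
    exact fun i => Real.iInf_nonneg fun m => by positivity
  · obtain ⟨N, hN⟩ := happrox (n + 1)
    filter_upwards [Filter.eventually_gt_atTop N] with i hi
    rw [← hN i hi]
    have hbdd : BddBelow (Set.range fun m : ℕ =>
        (markedGrowthFn (xi i) (m + 1) : ℝ) ^ ((1 : ℝ) / (m + 1))) :=
      ⟨0, Set.forall_mem_range.2 fun m => by positivity⟩
    exact ciInf_le hbdd n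
end
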